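/- arXiv:1203.3930 — 7 statements merged into one kernel-verified Lean document; each statement's English description precedes it below -/
import Mathlib

section
/- For every d and λ with λ ≤ d/(300·log d) there exist constants c, C > 0, depending only on d and λ, such that the following holds: for every finite connected 2n-vertex d-regular λ-bi-expander G (with n ≥ 3) and every vertex v₀ of G, the number of f ∈ Hom_{v₀}(G) satisfying c·log(log n) ≤ max_{v ∈ V(G)} |f(v)| ≤ C·log(log n) is at least (1 − 1/n²) times the total number of functions in Hom_{v₀}(G). -/
/-- Number of pairs (a,b) ∈ S × T with {a,b} an edge of G. -/
def edgeCount {V : Type*} (G : SimpleGraph V) [DecidableRel G.Adj]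
    (S T : Finset V) : ℕ :=
  ((S ×ˢ T).filter (fun p => G.Adj p.1 p.2)).card

/-- `G` is a `d`-regular `λ`-bi-expander with `2n` vertices and color classes `V0`, `V1`. -/
def IsBiExpander {V : Type*} [Fintype V] (G : SimpleGraph V) [DecidableRel G.Adj]
    (V0 V1 : Finset V) (n d : ℕ) (lam : ℝ) : Prop :=
  Fintype.card V = 2 * n ∧ V0.card = n ∧ V1.card = n ∧
  (∀ v : V, v ∈ V0 ∨ v ∈ V1) ∧ Disjoint V0 V1 ∧
  (∀ u v : V, G.Adj u v → (u ∈ V0 ∧ v ∈ V1) ∨ (u ∈ V1 ∧ v ∈ V0)) ∧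
  (∀ v : V, G.degree v = d) ∧
  ∀ S T : Finset V, S ⊆ V0 → T ⊆ V1 →
    |(edgeCount G S T : ℝ) - (d : ℝ) / (n : ℝ) * S.card * T.card| ≤
      lam * Real.sqrt ((S.card : ℝ) * T.card)

/-- Graph homomorphisms from `G` to `ℤ` vanishing at `v₀`. -/
def HomSet {V : Type*} (G : SimpleGraph V) (v₀ : V) : Set (V → ℤ) :=
  {f | f v₀ = 0 ∧ ∀ u v : V, G.Adj u v → |f u - f v| = 1}

namespace BiExpander

section TourSupports

variable {W : Type*} [DecidableEq W]

/-- Supports of the walks with `L` steps that start at `v`, where a step goes from `w` to a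
member of `nb w`. -/
def tourSupports (nb : W → Finset W) : ℕ → W → Finset (Finset W)
  | 0, v => {{v}}
  | L + 1, v => (nb v).biUnion fun w => (tourSupports nb L w).image (insert v)

theorem card_tourSupports_le {nb : W → Finset W} {D : ℕ} (hD : ∀ w, (nb w).card ≤ D) (L : ℕ)
    (v : W) : (tourSupports nb L v).card ≤ D ^ L := by
  induction L generalizing v with
  | zero => simp [tourSupports]
  | succ L ih =>
    calc (tourSupports nb (L + 1) v).card
        ≤ (nb v).card * D ^ L :=
          Finset.card_biUnion_le_card_mul _ _ _ fun w _ => Finset.card_image_le.trans (ih w)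
      _ ≤ D * D ^ L := Nat.mul_le_mul_right _ (hD v)
      _ = D ^ (L + 1) := by ring

theorem mem_of_mem_tourSupports {nb : W → Finset W} {L : ℕ} {v : W} {T : Finset W}
    (hT : T ∈ tourSupports nb L v) : v ∈ T := by
  cases L with
  | zero => simp_all [tourSupports]
  | succ L =>
    simp only [tourSupports, Finset.mem_biUnion, Finset.mem_image] at hT
    obtain ⟨w, -, T', -, rfl⟩ := hT
    simp

/-- A detour from `x` to `y` and back adds `y` to the support of a walk through `x`. -/
theorem insert_mem_tourSupports {nb : W → Finset W} {L : ℕ} {v x y : W} {T : Finset W}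
    (hT : T ∈ tourSupports nb L v) (hx : x ∈ T) (hxy : y ∈ nb x) (hyx : x ∈ nb y) :
    insert y T ∈ tourSupports nb (L + 2) v := by
  induction L generalizing v T with
  | zero =>
    simp only [tourSupports, Finset.mem_singleton] at hT
    subst hT
    rw [Finset.mem_singleton] at hx
    subst hx
    simp only [tourSupports, Finset.mem_biUnion, Finset.mem_image]
    exact ⟨y, hxy, _, ⟨x, hyx, {x}, by simp, rfl⟩, by ext; simp⟩
  | succ L ih =>
    have hT' := hT
    rw [tourSupports] at hT'
    simp only [Finset.mem_biUnion, Finset.mem_image] at hT'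
    obtain ⟨w, hw, T', hT', rfl⟩ := hT'
    by_cases hxv : x = v
    · subst hxv
      rw [tourSupports, Finset.mem_biUnion]
      refine ⟨y, hxy, Finset.mem_image.2 ⟨insert y (insert x T'), ?_, by ext; simp⟩⟩
      rw [tourSupports, Finset.mem_biUnion]
      exact ⟨x, hyx, Finset.mem_image.2 ⟨_, hT, rfl⟩⟩
    · have hx' : x ∈ T' := by simpa [hxv] using hx
      rw [tourSupports, Finset.mem_biUnion]
      exact ⟨w, hw, Finset.mem_image.2 ⟨_, ih hT' hx', by ext; simp; tauto⟩⟩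

/-- A connected finite set containing `v` is the support of a walk from `v` that traverses a
spanning tree twice. -/
theorem mem_tourSupports_of_connected {nb : W → Finset W} (hsymm : ∀ x y, y ∈ nb x → x ∈ nb y)
    {S : Finset W} {v : W} (hv : v ∈ S)
    (hS : ∀ T ⊆ S, v ∈ T → T ≠ S → ∃ x ∈ T, ∃ y ∈ S, y ∉ T ∧ y ∈ nb x) :
    S ∈ tourSupports nb (2 * (S.card - 1)) v := by
  have key : ∀ k, k + 1 ≤ S.card → ∃ T ⊆ S, T.card = k + 1 ∧ T ∈ tourSupports nb (2 * k) v := by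
    intro k
    induction k with
    | zero => exact fun _ => ⟨{v}, by simpa using hv, by simp, by simp [tourSupports]⟩
    | succ k ih =>
      intro hk
      obtain ⟨T, hTS, hcard, hT⟩ := ih (by omega)
      obtain ⟨x, hx, y, hy, hyT, hxy⟩ := hS T hTS (mem_of_mem_tourSupports hT) (by
        rintro rfl
        omega)
      exact ⟨insert y T, Finset.insert_subset hy hTS, by rw [Finset.card_insert_of_notMem hyT, hcard],
        insert_mem_tourSupports hT hx hxy (hsymm _ _ hxy)⟩
  have hpos : 0 < S.card := Finset.card_pos.2 ⟨v, hv⟩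
  obtain ⟨T, hTS, hcard, hT⟩ := key (S.card - 1) (by omega)
  rwa [Finset.eq_of_subset_of_card_le hTS (by omega)] at hT

end TourSupports

section Basic

variable {V : Type*}

/-- Functions that change by exactly one along every edge. -/
def IsIntHom (G : SimpleGraph V) (f : V → ℤ) : Prop :=
  ∀ u v, G.Adj u v → |f u - f v| = 1

theorem IsIntHom.add_const {G : SimpleGraph V} {f : V → ℤ} (hf : IsIntHom G f) (m : ℤ) :
    IsIntHom G fun v => f v + m := by
  intro u v h
  simpa using hf u v h

theorem IsIntHom.neg {G : SimpleGraph V} {f : V → ℤ} (hf : IsIntHom G f) :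
    IsIntHom G fun v => -f v := by
  intro u v h
  rw [← hf u v h, ← abs_neg]
  congr 1
  ring

theorem IsIntHom.cases {G : SimpleGraph V} {f : V → ℤ} (hf : IsIntHom G f) {u v : V}
    (h : G.Adj u v) : f u = f v + 1 ∨ f u = f v - 1 := by
  have := hf u v h
  rcases (abs_eq (by norm_num)).1 this with h | h <;> omega

theorem IsIntHom.abs_sub_le_length {G : SimpleGraph V} {f : V → ℤ} (hf : IsIntHom G f) {u v : V}
    (p : G.Walk u v) : |f u - f v| ≤ p.length := by
  induction p with
  | nil => simp
  | cons h p ih =>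
    have := hf.cases h
    rw [abs_le] at ih ⊢
    push_cast [SimpleGraph.Walk.length_cons]
    omega

theorem IsIntHom.even_sub_length {G : SimpleGraph V} {f : V → ℤ} (hf : IsIntHom G f) {u v : V}
    (p : G.Walk u v) : Even (f u - f v - p.length) := by
  induction p with
  | nil => simp
  | cons h p ih =>
    have := hf.cases h
    rw [Int.even_iff] at ih ⊢
    push_cast [SimpleGraph.Walk.length_cons]
    omega

theorem edgeCount_comm {G : SimpleGraph V} [DecidableRel G.Adj] (S T : Finset V) :
    edgeCount G S T = edgeCount G T S := by
  unfold edgeCount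
  refine Finset.card_bij' (fun p _ => p.swap) (fun p _ => p.swap) ?_ ?_ ?_ ?_ <;>
    simp +contextual [G.adj_comm]

/-- In a regular graph, a set is at least as large as the set of vertices all of whose neighbours
it contains. -/
theorem card_le_of_neighbors_subset [Fintype V] {G : SimpleGraph V} [DecidableRel G.Adj]
    {d : ℕ} (hd : 0 < d) (hdeg : ∀ v, G.degree v = d) {B I : Finset V}
    (hI : ∀ u ∈ I, ∀ x, G.Adj u x → x ∈ B) : I.card ≤ B.card := by
  have := Finset.card_mul_le_card_mul (s := I) (t := B) (m := d) (n := d) G.Adj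
    (fun u hu => by
      rw [← hdeg u, ← SimpleGraph.card_neighborFinset_eq_degree]
      refine Finset.card_le_card fun x hx => ?_
      rw [SimpleGraph.mem_neighborFinset] at hx
      exact Finset.mem_filter.2 ⟨hI u hu x hx, hx⟩)
    (fun x _ => by
      rw [← hdeg x, ← SimpleGraph.card_neighborFinset_eq_degree]
      refine Finset.card_le_card fun u hu => ?_
      rw [SimpleGraph.mem_neighborFinset]
      exact (Finset.mem_filter.1 hu).2.symm)
  exact Nat.le_of_mul_le_mul_right this hd

theorem finite_homSet [Finite V] {G : SimpleGraph V} (hG : G.Connected) (v₀ : V) :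
    (HomSet G v₀).Finite := by
  refine (Set.Finite.pi' fun v : V =>
    Set.finite_Icc (-(G.dist v v₀ : ℤ)) (G.dist v v₀)).subset ?_
  rintro f ⟨h0, hf⟩ v
  obtain ⟨p, hp⟩ := hG.exists_walk_length_eq_dist v v₀
  have := IsIntHom.abs_sub_le_length hf p
  rw [h0, sub_zero, hp, abs_le] at this
  exact this

end Basic

section Expansion

variable {V : Type*} [Fintype V] {G : SimpleGraph V} [DecidableRel G.Adj]
  {V0 V1 : Finset V} {n d : ℕ} {lam : ℝ}

theorem isBiExpander_symm (h : IsBiExpander G V0 V1 n d lam) : IsBiExpander G V1 V0 n d lam := by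
  obtain ⟨h1, h2, h3, h4, h5, h6, h7, h8⟩ := h
  refine ⟨h1, h3, h2, fun v => (h4 v).symm, h5.symm, fun u v huv => (h6 u v huv).symm, h7, ?_⟩
  intro S T hS hT
  have := h8 T S hT hS
  rw [edgeCount_comm, mul_comm (S.card : ℝ), mul_assoc, mul_comm (S.card : ℝ), ← mul_assoc]
  exact this

/-- Of two sets without edges between them, one is small. -/
theorem card_le_or_card_le_of_not_adj (h : IsBiExpander G V0 V1 n d lam) (hn : 0 < n) (hd : 0 < d)
    {ε : ℝ} (hε : 0 < ε) (hlam : lam ≤ ε * d) {S T : Finset V} (hS : S ⊆ V0)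
    (hT : T ⊆ V1) (hST : ∀ x ∈ S, ∀ y ∈ T, ¬ G.Adj x y) :
    (S.card : ℝ) ≤ ε * n ∨ (T.card : ℝ) ≤ ε * n := by
  obtain ⟨-, -, -, -, -, -, -, h8⟩ := h
  have hmix := (abs_le.1 (h8 S T hS hT)).1
  have h0 : edgeCount G S T = 0 := by
    rw [edgeCount, Finset.card_eq_zero, Finset.filter_eq_empty_iff]
    rintro ⟨x, y⟩ hxy
    rw [Finset.mem_product] at hxy
    exact hST x hxy.1 y hxy.2
  rw [h0] at hmix
  by_contra! hlt
  set s : ℝ := (S.card : ℝ)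
  set t : ℝ := (T.card : ℝ)
  have hnpos : (0 : ℝ) < n := by exact_mod_cast hn
  have hdpos : (0 : ℝ) < d := by exact_mod_cast hd
  have hsq : (ε * n) < √(s * t) := by
    refine Real.lt_sqrt_of_sq_lt ?_
    have : 0 < ε * n := by positivity
    nlinarith
  have hnn : 0 ≤ s * t := by positivity
  have h1 : d / n * s * t ≤ ε * d * √(s * t) := by
    have : lam * √(s * t) ≤ ε * d * √(s * t) := by gcongr
    push_cast at hmix
    linarith
  have h2 : √(s * t) * √(s * t) = s * t := Real.mul_self_sqrt hnn
  have hr : 0 < √(s * t) := lt_trans (by positivity) hsq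
  have h3 : d / n * s * t = d / n * √(s * t) * √(s * t) := by
    rw [mul_assoc, mul_assoc _ √(s * t), h2]
  rw [h3] at h1
  have h4 := le_of_mul_le_mul_right h1 hr
  rw [div_mul_eq_mul_div, div_le_iff₀ hnpos] at h4
  nlinarith

variable [DecidableEq V]

/-- The set of vertices with a neighbour in `A`. -/
def nbhd (G : SimpleGraph V) [DecidableRel G.Adj] (A : Finset V) : Finset V :=
  A.biUnion fun v => G.neighborFinset v

theorem mem_nbhd {A : Finset V} {u : V} : u ∈ nbhd G A ↔ ∃ x ∈ A, G.Adj x u := by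
  simp [nbhd]

theorem edgeCount_nbhd (hdeg : ∀ v, G.degree v = d) (A : Finset V) :
    edgeCount G A (nbhd G A) = d * A.card := by
  unfold edgeCount
  rw [Finset.card_filter, Finset.sum_product]
  have : ∀ x ∈ A, (∑ y ∈ nbhd G A, if G.Adj x y then 1 else 0) = d := by
    intro x hx
    rw [← Finset.card_filter, ← hdeg x, ← SimpleGraph.card_neighborFinset_eq_degree]
    congr 1
    ext y
    simp only [Finset.mem_filter, mem_nbhd, SimpleGraph.mem_neighborFinset]
    exact ⟨fun h => h.2, fun h => ⟨⟨x, hx, h⟩, h⟩⟩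
  rw [Finset.sum_congr rfl this]
  simp [mul_comm]

theorem nbhd_subset (h : IsBiExpander G V0 V1 n d lam) {A : Finset V} (hA : A ⊆ V0) :
    nbhd G A ⊆ V1 := by
  obtain ⟨-, -, -, -, h5, h6, -, -⟩ := h
  intro u hu
  obtain ⟨x, hx, hxu⟩ := mem_nbhd.1 hu
  rcases h6 x u hxu with h | h
  · exact h.2
  · exact absurd h.1 (Finset.disjoint_left.1 h5 (hA hx))

theorem mem_of_adj (h : IsBiExpander G V0 V1 n d lam) {x u : V} (hx : x ∈ V0) (hxu : G.Adj x u) :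
    u ∈ V1 :=
  nbhd_subset h (A := {x}) (by simpa using hx) (mem_nbhd.2 ⟨x, by simp, hxu⟩)

/-- Small sets expand. -/
theorem card_le_mul_card_nbhd (h : IsBiExpander G V0 V1 n d lam) (hn : 0 < n) (hd : 0 < d)
    {ε : ℝ} (hε : 0 < ε) (hε1 : ε ≤ 1) (hlam : lam ≤ ε * d) {A : Finset V} (hA : A ⊆ V0)
    (hcard : (A.card : ℝ) ≤ 2 * ε * n) : (A.card : ℝ) ≤ 4 * ε * (nbhd G A).card := by
  have hV1 := nbhd_subset h hA
  obtain ⟨-, -, -, -, -, -, h7, h8⟩ := h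
  have hmix := (abs_le.1 (h8 A _ hA hV1)).2
  rw [edgeCount_nbhd h7] at hmix
  push_cast at hmix
  rcases A.eq_empty_or_nonempty with rfl | hne
  · simp [nbhd]
  by_contra! hlt
  set N : ℝ := ((nbhd G A).card : ℝ) with hN
  set a : ℝ := (A.card : ℝ) with ha
  have hapos : 0 < a := by
    rw [ha]
    exact_mod_cast Finset.card_pos.2 hne
  have hNnn : 0 ≤ N := by positivity
  have hnpos : (0 : ℝ) < n := by exact_mod_cast hn
  have hdpos : (0 : ℝ) < d := by exact_mod_cast hd
  have hsqrt : ε * √(a * N) ≤ a / 2 := by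
    rw [← Real.sqrt_sq hε.le, ← Real.sqrt_mul (by positivity)]
    refine Real.sqrt_le_iff.2 ⟨by positivity, ?_⟩
    have : ε * (4 * ε * N) ≤ a := by nlinarith
    nlinarith
  have hlt2 : d / n * a * N < d * (a / 2) := by
    have : 2 * N < n := by
      have : 4 * ε * N < 2 * ε * n := by linarith
      nlinarith
    have h1 : d / n * a * N = d * a * (N / n) := by ring
    have h2 : N / n < 1 / 2 := by
      rw [div_lt_div_iff₀ hnpos (by norm_num)]
      linarith
    rw [h1]
    have : 0 < d * a := by positivity
    nlinarith
  have : lam * √(a * N) ≤ d * (a / 2) :=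
    calc lam * √(a * N) ≤ ε * d * √(a * N) := by gcongr
      _ = d * (ε * √(a * N)) := by ring
      _ ≤ d * (a / 2) := by gcongr
  linarith

end Expansion

section Flat

variable {V : Type*} [Fintype V] {G : SimpleGraph V} [DecidableRel G.Adj]
  {V0 V1 : Finset V} {n d : ℕ} {lam : ℝ}

theorem mem_iff_not_mem_of_adj (h : IsBiExpander G V0 V1 n d lam) {u v : V} (huv : G.Adj u v) :
    u ∈ V0 ↔ v ∉ V0 := by
  obtain ⟨-, -, -, -, h5, h6, -, -⟩ := h
  rw [Finset.disjoint_left] at h5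
  rcases h6 u v huv with h | h
  · exact iff_of_true h.1 fun h' => h5 h' h.2
  · exact iff_of_false (fun h' => h5 h' h.1) fun h' => h' h.2

theorem mem_right_iff (h : IsBiExpander G V0 V1 n d lam) {v : V} : v ∈ V1 ↔ v ∉ V0 := by
  obtain ⟨-, -, -, h4, h5, -, -, -⟩ := h
  rw [Finset.disjoint_left] at h5
  exact ⟨fun h1 h0 => h5 h0 h1, fun h0 => (h4 v).resolve_left h0⟩

theorem even_length_iff (h : IsBiExpander G V0 V1 n d lam) {u v : V} (p : G.Walk u v) :
    Even p.length ↔ (u ∈ V0 ↔ v ∈ V0) := by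
  induction p with
  | nil => simp
  | cons huv p ih =>
    rw [SimpleGraph.Walk.length_cons, Nat.even_add_one, ih, mem_iff_not_mem_of_adj h huv]
    tauto

theorem even_sub_iff (h : IsBiExpander G V0 V1 n d lam) (hG : G.Connected) {f : V → ℤ}
    (hf : IsIntHom G f) (u v : V) : Even (f u - f v) ↔ (u ∈ V0 ↔ v ∈ V0) := by
  obtain ⟨p⟩ := hG.preconnected u v
  rw [← even_length_iff h p, ← Int.even_coe_nat]
  exact Int.even_sub.1 (hf.even_sub_length p)

/-- An integer homomorphism is constant on most of one of the two color classes. -/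
theorem exists_flat (h : IsBiExpander G V0 V1 n d lam) (hG : G.Connected) (hn : 0 < n)
    (hd : 0 < d) {ε : ℝ} (hε : 0 < ε) (hε1 : ε < 1) (hlam : lam ≤ ε * d) {f : V → ℤ}
    (hf : IsIntHom G f) :
    ∃ X m, (X = V0 ∨ X = V1) ∧ ((X.filter fun x => f x ≠ m).card : ℝ) ≤ 2 * ε * n := by
  have hV0 : V0.card = n := h.2.1
  have hV1 : V1.card = n := h.2.2.1
  obtain ⟨x₀, hx₀⟩ : V0.Nonempty := Finset.card_pos.1 (by omega)
  set cls : ℤ → Finset V := fun k => if Even (k - f x₀) then V0 else V1 with hcls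
  have hclscard : ∀ k, (cls k).card = n := fun k => by
    simp only [hcls]
    split_ifs <;> assumption
  have hpar : ∀ k, ∀ u ∈ cls k, Even (f u - k) := by
    intro k u hu
    have hev := even_sub_iff h hG hf u x₀
    simp only [hcls] at hu
    split_ifs at hu with hk
    · have := hev.2 (iff_of_true hu hx₀)
      rw [Int.even_iff] at *
      omega
    · rw [mem_right_iff h] at hu
      have : ¬ Even (f u - f x₀) := fun h' => hu ((hev.1 h').2 hx₀)
      rw [Int.even_iff] at *
      omega
  have hnpos : (0 : ℝ) < n := by exact_mod_cast hn
  set b : ℤ := ∑ v, |f v|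
  have hb : ∀ v, |f v| ≤ b := fun v =>
    Finset.single_le_sum (f := fun v => |f v|) (fun _ _ => abs_nonneg _) (Finset.mem_univ v)
  obtain ⟨m, hm, hmax⟩ := Int.exists_greatest_of_bdd
    (P := fun k => (((cls k).filter fun x => f x < k).card : ℝ) ≤ ε * n)
    ⟨b, fun k hk => by
      by_contra! hlt
      rw [Finset.filter_true_of_mem, hclscard] at hk
      · nlinarith
      · exact fun x _ => lt_of_le_of_lt ((le_abs_self _).trans (hb x)) hlt⟩
    ⟨-b, by
      rw [Finset.filter_false_of_mem]
      · simpa using (by positivity : 0 ≤ ε * n)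
      · intro x _
        have := (abs_le.1 (hb x)).1
        omega⟩
  have hbig : ¬ (((cls (m + 1)).filter fun x => f x < m + 1).card : ℝ) ≤ ε * n := fun h' => by
    have := hmax _ h'
    omega
  have hnadj : ∀ x ∈ (cls m).filter (fun x => m + 2 ≤ f x),
      ∀ y ∈ (cls (m + 1)).filter (fun x => f x < m + 1), ¬ G.Adj x y := by
    intro x hx y hy hxy
    have := hf.cases hxy
    have := (Finset.mem_filter.1 hx).2
    have := (Finset.mem_filter.1 hy).2
    omega
  have hU : (((cls m).filter fun x => m + 2 ≤ f x).card : ℝ) ≤ ε * n := by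
    by_cases hev : Even (m - f x₀)
    · have h0 : cls m = V0 := if_pos hev
      have h1 : cls (m + 1) = V1 := if_neg (by rw [Int.even_iff] at *; omega)
      exact (card_le_or_card_le_of_not_adj h hn hd hε hlam
        ((Finset.filter_subset _ _).trans h0.subset)
        ((Finset.filter_subset _ _).trans h1.subset) hnadj).resolve_right hbig
    · have h0 : cls m = V1 := if_neg hev
      have h1 : cls (m + 1) = V0 := if_pos (by rw [Int.even_iff] at *; omega)
      exact (card_le_or_card_le_of_not_adj (isBiExpander_symm h) hn hd hε hlam
        ((Finset.filter_subset _ _).trans h0.subset)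
        ((Finset.filter_subset _ _).trans h1.subset) hnadj).resolve_right hbig
  refine ⟨cls m, m, ?_, ?_⟩
  · simp only [hcls]
    split_ifs <;> simp
  · classical
    have hsub : (cls m).filter (fun x => f x ≠ m) ⊆
        (cls m).filter (fun x => f x < m) ∪ (cls m).filter fun x => m + 2 ≤ f x := by
      intro x hx
      rw [Finset.mem_filter] at hx
      have := hpar m x hx.1
      rw [Int.even_iff] at this
      simp only [Finset.mem_union, Finset.mem_filter, hx.1, true_and]
      omega
    have hle : (((cls m).filter fun x => f x ≠ m).card : ℝ) ≤
        ((cls m).filter fun x => f x < m).card + ((cls m).filter fun x => m + 2 ≤ f x).card := by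
      exact_mod_cast (Finset.card_le_card hsub).trans (Finset.card_union_le _ _)
    linarith

end Flat

section FlatSet

variable {V : Type*} {G : SimpleGraph V}

/-- Integer homomorphisms that vanish on all but at most `q` vertices of `X`. -/
def flatSet (G : SimpleGraph V) (X : Finset V) (q : ℝ) : Set (V → ℤ) :=
  {h | IsIntHom G h ∧ ((X.filter fun x => h x ≠ 0).card : ℝ) ≤ q}

theorem injOn_flatSet (G : SimpleGraph V) {X : Finset V} {q : ℝ} (hq : 2 * q < X.card) (v₀ : V) :
    Set.InjOn (fun (h : V → ℤ) v => h v - h v₀) (flatSet G X q) := by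
  classical
  rintro g ⟨-, hg⟩ h ⟨-, hh⟩ hgh
  have hex : ∃ x ∈ X, g x = 0 ∧ h x = 0 := by
    by_contra! hne
    have hsub : X ⊆ X.filter (fun x => g x ≠ 0) ∪ X.filter fun x => h x ≠ 0 := by
      intro x hx
      have := hne x hx
      simp only [Finset.mem_union, Finset.mem_filter, hx, true_and]
      tauto
    have : (X.card : ℝ) ≤ (X.filter fun x => g x ≠ 0).card + (X.filter fun x => h x ≠ 0).card := by
      exact_mod_cast (Finset.card_le_card hsub).trans (Finset.card_union_le _ _)
    linarith
  obtain ⟨x, -, hgx, hhx⟩ := hex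
  have h1 := congrFun hgh x
  funext v
  have h2 := congrFun hgh v
  simp only at h1 h2
  omega

theorem mapsTo_flatSet (G : SimpleGraph V) (X : Finset V) (q : ℝ) (v₀ : V) :
    Set.MapsTo (fun (h : V → ℤ) v => h v - h v₀) (flatSet G X q) (HomSet G v₀) := by
  rintro h ⟨hh, -⟩
  exact ⟨sub_self _, fun u v huv => by simpa using hh u v huv⟩

theorem finite_flatSet [Finite V] (hG : G.Connected) {X : Finset V} {q : ℝ} (hq : 2 * q < X.card) :
    (flatSet G X q).Finite :=
  Set.Finite.of_injOn (mapsTo_flatSet G X q hG.nonempty.some) (injOn_flatSet G hq _)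
    (finite_homSet hG _)

theorem ncard_flatSet_le [Finite V] (hG : G.Connected) {X : Finset V} {q : ℝ}
    (hq : 2 * q < X.card) (v₀ : V) :
    (flatSet G X q).ncard ≤ (HomSet G v₀).ncard :=
  Set.ncard_le_ncard_of_injOn _ (fun _ h => mapsTo_flatSet G X q v₀ h) (injOn_flatSet G hq v₀)
    (finite_homSet hG v₀)

end FlatSet

section Peak

variable {V : Type*} {G : SimpleGraph V} {V0 V1 : Finset V} {h : V → ℤ} {v : V}

/-- A step between vertices at distance two whose endpoint lies in `V0` at height at least two. -/
def PeakStep (G : SimpleGraph V) (V0 : Finset V) (h : V → ℤ) (x y : V) : Prop :=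
  y ∈ V0 ∧ 2 ≤ h y ∧ ∃ u, G.Adj x u ∧ G.Adj u y

open Classical in
/-- The part of `V0` that can be reached from `v` by two-edge steps within `{h ≥ 2}`. -/
noncomputable def peak (G : SimpleGraph V) (V0 : Finset V) (h : V → ℤ) (v : V) : Finset V :=
  V0.filter fun x => Relation.ReflTransGen (PeakStep G V0 h) v x

theorem mem_peak {x : V} :
    x ∈ peak G V0 h v ↔ x ∈ V0 ∧ Relation.ReflTransGen (PeakStep G V0 h) v x := by
  classical
  exact Finset.mem_filter

theorem peak_subset : peak G V0 h v ⊆ V0 := fun _ hx => (mem_peak.1 hx).1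

theorem self_mem_peak (hv : v ∈ V0) : v ∈ peak G V0 h v :=
  mem_peak.2 ⟨hv, .refl⟩

theorem two_le_of_mem_peak (hv : 2 ≤ h v) {x : V} (hx : x ∈ peak G V0 h v) : 2 ≤ h x := by
  rcases Relation.ReflTransGen.cases_tail (mem_peak.1 hx).2 with rfl | ⟨y, -, hy⟩
  · exact hv
  · exact hy.2.1

theorem mem_peak_of_step {x u y : V} (hx : x ∈ peak G V0 h v) (hxu : G.Adj x u) (huy : G.Adj u y)
    (hy : y ∈ V0) (hhy : 2 ≤ h y) : y ∈ peak G V0 h v :=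
  mem_peak.2 ⟨hy, (mem_peak.1 hx).2.tail ⟨hy, hhy, u, hxu, huy⟩⟩

variable [DecidableEq V]

/-- The graph of `h` on its peak at `v`. -/
noncomputable def peakGraph (G : SimpleGraph V) (V0 : Finset V) (h : V → ℤ) (v : V) :
    Finset (V × ℤ) :=
  (peak G V0 h v).image fun x => (x, h x)

theorem card_peakGraph : (peakGraph G V0 h v).card = (peak G V0 h v).card :=
  Finset.card_image_of_injective _ fun _ _ hxy => congrArg Prod.fst hxy

theorem image_fst_peakGraph : (peakGraph G V0 h v).image Prod.fst = peak G V0 h v := by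
  simp [peakGraph, Finset.image_image, Function.comp_def]

theorem mem_peakGraph_iff {p : V × ℤ} :
    p ∈ peakGraph G V0 h v ↔ p.1 ∈ peak G V0 h v ∧ h p.1 = p.2 := by
  simp only [peakGraph, Finset.mem_image]
  constructor
  · rintro ⟨x, hx, rfl⟩
    exact ⟨hx, rfl⟩
  · rintro ⟨hx, hp⟩
    exact ⟨p.1, hx, Prod.ext rfl hp⟩

variable [Fintype V] [DecidableRel G.Adj]

/-- Pairs whose vertex is two edges away and whose height differs by at most two. -/
noncomputable def pairNbhd (G : SimpleGraph V) [DecidableRel G.Adj] (p : V × ℤ) : Finset (V × ℤ) :=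
  nbhd G (nbhd G {p.1}) ×ˢ Finset.Icc (p.2 - 2) (p.2 + 2)

theorem mem_pairNbhd {p q : V × ℤ} : q ∈ pairNbhd G p ↔
    (∃ u, G.Adj p.1 u ∧ G.Adj u q.1) ∧ p.2 - 2 ≤ q.2 ∧ q.2 ≤ p.2 + 2 := by
  simp [pairNbhd, mem_nbhd]

theorem pairNbhd_symm (p q : V × ℤ) (hpq : q ∈ pairNbhd G p) : p ∈ pairNbhd G q := by
  rw [mem_pairNbhd] at *
  obtain ⟨⟨u, h1, h2⟩, h3, h4⟩ := hpq
  exact ⟨⟨u, h2.symm, h1.symm⟩, by omega, by omega⟩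

theorem card_nbhd_le {d : ℕ} (hdeg : ∀ v, G.degree v = d) (A : Finset V) :
    (nbhd G A).card ≤ A.card * d :=
  Finset.card_biUnion_le_card_mul _ _ _ fun v _ => (hdeg v).le

theorem card_pairNbhd_le {d : ℕ} (hdeg : ∀ v, G.degree v = d) (p : V × ℤ) :
    (pairNbhd G p).card ≤ 5 * d ^ 2 := by
  rw [pairNbhd, Finset.card_product, Int.card_Icc]
  have h1 : (p.2 + 2 + 1 - (p.2 - 2)).toNat = 5 := by omega
  have h2 := card_nbhd_le hdeg {p.1}
  have h3 := card_nbhd_le hdeg (nbhd G {p.1})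
  rw [Finset.card_singleton, one_mul] at h2
  rw [h1]
  nlinarith

theorem peakGraph_mem_tourSupports (hh : IsIntHom G h) (hv : v ∈ V0) :
    peakGraph G V0 h v ∈
      tourSupports (pairNbhd G) (2 * ((peak G V0 h v).card - 1)) (v, h v) := by
  rw [← card_peakGraph]
  refine mem_tourSupports_of_connected pairNbhd_symm
    (mem_peakGraph_iff.2 ⟨self_mem_peak hv, rfl⟩) fun T hT hvT hne => ?_
  by_contra! hclosed
  refine hne (hT.antisymm fun p hp => ?_)
  obtain ⟨hp1, hp2⟩ := mem_peakGraph_iff.1 hp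
  have key : ∀ x, Relation.ReflTransGen (PeakStep G V0 h) v x → (x, h x) ∈ T := by
    intro x hx
    induction hx with
    | refl => exact hvT
    | tail hxy hstep ih =>
      rename_i x y
      by_contra hyT
      obtain ⟨hy, hhy, u, hxu, huy⟩ := hstep
      refine hclosed _ ih (y, h y) (mem_peakGraph_iff.2 ⟨?_, rfl⟩) hyT
        (mem_pairNbhd.2 ⟨⟨u, hxu, huy⟩, ?_⟩)
      · exact mem_peak.2 ⟨hy, hxy.tail ⟨hy, hhy, u, hxu, huy⟩⟩
      · have h1 := hh.cases hxu
        have h2 := hh.cases huy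
        exact ⟨by simp only; omega, by simp only; omega⟩
  have := key p.1 (mem_peak.1 hp1).2
  rwa [hp2] at this

variable {n d : ℕ} {lam : ℝ}

/-- A high peak is large: its level sets at least double from one even height to the next. -/
theorem two_pow_le_card_peak (hexp : IsBiExpander G V0 V1 n d lam) (hn : 0 < n) (hd : 0 < d)
    {ε : ℝ} (hε : 0 < ε) (hε8 : 8 * ε ≤ 1) (hlam : lam ≤ ε * d) (hh : IsIntHom G h)
    (hcard : ((peak G V0 h v).card : ℝ) ≤ 2 * ε * n) (hv : v ∈ V0) {k : ℕ}
    (hk : 2 * ((k : ℤ) + 1) ≤ h v) : 2 ^ k ≤ (peak G V0 h v).card := by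
  set B : ℕ → Finset V := fun i => (peak G V0 h v).filter fun x => 2 * ((i : ℤ) + 1) ≤ h x with hB
  have hstep : ∀ i, 2 * (B (i + 1)).card ≤ (B i).card := by
    intro i
    have hsub : B (i + 1) ⊆ V0 := (Finset.filter_subset _ _).trans peak_subset
    have hle : ((B (i + 1)).card : ℝ) ≤ 2 * ε * n :=
      le_trans (by exact_mod_cast Finset.card_le_card (Finset.filter_subset _ _)) hcard
    have h1 := card_le_mul_card_nbhd hexp hn hd hε (by linarith) hlam hsub hle
    have h2 : (nbhd G (B (i + 1))).card ≤ (B i).card := by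
      refine card_le_of_neighbors_subset hd hexp.2.2.2.2.2.2.1 fun u hu x hux => ?_
      obtain ⟨y, hy, hyu⟩ := mem_nbhd.1 hu
      obtain ⟨hyp, hhy⟩ := Finset.mem_filter.1 hy
      have h1 := hh.cases hyu
      have h2 := hh.cases hux
      push_cast at hhy
      refine Finset.mem_filter.2 ⟨mem_peak_of_step hyp hyu hux ?_ (by omega), by omega⟩
      exact mem_of_adj (isBiExpander_symm hexp) (mem_of_adj hexp (peak_subset hyp) hyu) hux
    have h3 : ((nbhd G (B (i + 1))).card : ℝ) ≤ (B i).card := by exact_mod_cast h2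
    have h4 : 2 * ((B (i + 1)).card : ℝ) ≤ (B i).card := by
      have : 0 ≤ ((nbhd G (B (i + 1))).card : ℝ) := by positivity
      nlinarith
    exact_mod_cast h4
  have hpow : ∀ i, 2 ^ i * (B i).card ≤ (peak G V0 h v).card := by
    intro i
    induction i with
    | zero => simpa using Finset.card_le_card (Finset.filter_subset _ _)
    | succ i ih =>
      calc 2 ^ (i + 1) * (B (i + 1)).card = 2 ^ i * (2 * (B (i + 1)).card) := by ring
        _ ≤ 2 ^ i * (B i).card := Nat.mul_le_mul_left _ (hstep i)
        _ ≤ _ := ih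
  have hpos : 0 < (B k).card :=
    Finset.card_pos.2 ⟨v, Finset.mem_filter.2 ⟨self_mem_peak hv, hk⟩⟩
  exact le_trans (Nat.le_mul_of_pos_right _ hpos) (hpow k)

end Peak

section Switch

variable {V : Type*} [Fintype V] {G : SimpleGraph V} [DecidableRel G.Adj]
  {V0 V1 : Finset V} {n d : ℕ} {lam : ℝ} {v : V} {q : ℝ}

theorem even_of_mem_flatSet (hexp : IsBiExpander G V0 V1 n d lam) (hG : G.Connected)
    (hq : 2 * q < V0.card) {h : V → ℤ} (hh : h ∈ flatSet G V0 q) {x : V} (hx : x ∈ V0) :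
    Even (h x) := by
  obtain ⟨y, hy, hy0⟩ : ∃ y ∈ V0, h y = 0 := by
    by_contra! hne
    have := hh.2
    rw [Finset.filter_true_of_mem hne] at this
    have : (0 : ℝ) ≤ V0.card := by positivity
    linarith
  have := (even_sub_iff hexp hG hh.1 x y).2 (iff_of_true hx hy)
  rwa [hy0, sub_zero] at this

variable [DecidableEq V]

/-- Neighbours of `A` that also have a neighbour outside `A`. -/
def rim (G : SimpleGraph V) [DecidableRel G.Adj] (A : Finset V) : Finset V :=
  (nbhd G A).filter fun u => ∃ x, G.Adj u x ∧ x ∉ A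

theorem card_nbhd_le_card_rim_add (hd : 0 < d) (hdeg : ∀ v, G.degree v = d) (A : Finset V) :
    (nbhd G A).card ≤ (rim G A).card + A.card := by
  rw [← Finset.card_filter_add_card_filter_not (s := nbhd G A) fun u => ∃ x, G.Adj u x ∧ x ∉ A]
  refine Nat.add_le_add_left (card_le_of_neighbors_subset hd hdeg fun u hu x hux => ?_) _
  by_contra hx
  exact (Finset.mem_filter.1 hu).2 ⟨x, hux, hx⟩

/-- Flatten `h` to zero on `A`, choosing the signs on the rim of `A` according to `T`, and
recording in the remaining neighbours `u` of `A` the increment of `h` from `w u` to `u`. -/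
def flatten (G : SimpleGraph V) [DecidableRel G.Adj] (A : Finset V) (w : V → V) (T : Finset V)
    (h : V → ℤ) (u : V) : ℤ :=
  if u ∈ A then 0
  else if u ∈ rim G A then (if u ∈ T then 1 else -1)
  else if u ∈ nbhd G A then h u - h (w u)
  else h u

theorem eq_zero_of_adj_nbhd_peak (hexp : IsBiExpander G V0 V1 n d lam) (hG : G.Connected)
    (hq : 2 * q < V0.card) {h : V → ℤ} (hh : h ∈ flatSet G V0 q) (hv : 2 ≤ h v) {u x : V}
    (hu : u ∈ nbhd G (peak G V0 h v)) (hux : G.Adj u x) (hx : x ∉ peak G V0 h v) : h x = 0 := by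
  obtain ⟨y, hy, hyu⟩ := mem_nbhd.1 hu
  have hxV0 : x ∈ V0 :=
    mem_of_adj (isBiExpander_symm hexp) (mem_of_adj hexp (peak_subset hy) hyu) hux
  have h1 := two_le_of_mem_peak hv hy
  have h2 := hh.1.cases hyu
  have h3 := hh.1.cases hux
  have h4 : ¬ 2 ≤ h x := fun h' => hx (mem_peak_of_step hy hyu hux hxV0 h')
  have h5 := even_of_mem_flatSet hexp hG hq hh hxV0
  rw [Int.even_iff] at h5
  omega

theorem eq_one_of_mem_rim_peak (hexp : IsBiExpander G V0 V1 n d lam) (hG : G.Connected)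
    (hq : 2 * q < V0.card) {h : V → ℤ} (hh : h ∈ flatSet G V0 q) (hv : 2 ≤ h v) {u : V}
    (hu : u ∈ rim G (peak G V0 h v)) : h u = 1 := by
  obtain ⟨hu, x, hux, hx⟩ := Finset.mem_filter.1 hu
  have h0 := eq_zero_of_adj_nbhd_peak hexp hG hq hh hv hu hux hx
  obtain ⟨y, hy, hyu⟩ := mem_nbhd.1 hu
  have h1 := two_le_of_mem_peak hv hy
  have h2 := hh.1.cases hyu
  have h3 := hh.1.cases hux
  omega

theorem notMem_peak_of_mem_nbhd (hexp : IsBiExpander G V0 V1 n d lam) {h : V → ℤ} {u : V}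
    (hu : u ∈ nbhd G (peak G V0 h v)) : u ∉ peak G V0 h v := fun hu' =>
  (mem_right_iff hexp).1 (nbhd_subset hexp peak_subset hu) (peak_subset hu')

theorem flatten_mem_flatSet (hexp : IsBiExpander G V0 V1 n d lam) (hG : G.Connected)
    (hq : 2 * q < V0.card) {h : V → ℤ} (hh : h ∈ flatSet G V0 q) (hv : 2 ≤ h v) {w : V → V}
    (hw : ∀ u ∈ nbhd G (peak G V0 h v), G.Adj (w u) u) (T : Finset V) :
    flatten G (peak G V0 h v) w T h ∈ flatSet G V0 q := by
  set A := peak G V0 h v with hA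
  have hval : ∀ u ∈ nbhd G A, |flatten G A w T h u| = 1 := by
    intro u hu
    have huA := notMem_peak_of_mem_nbhd hexp hu
    unfold flatten
    rw [if_neg huA]
    by_cases hr : u ∈ rim G A
    · rw [if_pos hr]
      split_ifs <;> simp
    · rw [if_neg hr, if_pos hu, abs_sub_comm]
      exact hh.1 _ _ (hw u hu)
  have hadj : ∀ x u, x ∈ V0 → G.Adj x u → |flatten G A w T h x - flatten G A w T h u| = 1 := by
    intro x u hx hxu
    have hxN : x ∉ nbhd G A := fun h' => (mem_right_iff hexp).1 (nbhd_subset hexp peak_subset h') hx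
    have hxr : x ∉ rim G A := fun h' => hxN (Finset.filter_subset _ _ h')
    by_cases hu : u ∈ nbhd G A
    · have hx0 : flatten G A w T h x = 0 := by
        unfold flatten
        by_cases hxA : x ∈ A
        · rw [if_pos hxA]
        · rw [if_neg hxA, if_neg hxr, if_neg hxN]
          exact eq_zero_of_adj_nbhd_peak hexp hG hq hh hv hu hxu.symm hxA
      rw [hx0, zero_sub, abs_neg, hval u hu]
    · have hxA : x ∉ A := fun h' => hu (mem_nbhd.2 ⟨x, h', hxu⟩)
      have hur : u ∉ rim G A := fun h' => hu (Finset.filter_subset _ _ h')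
      have huA : u ∉ A := fun h' =>
        (mem_right_iff hexp).1 (mem_of_adj hexp hx hxu) (peak_subset h')
      unfold flatten
      rw [if_neg hxA, if_neg hxr, if_neg hxN, if_neg huA, if_neg hur, if_neg hu]
      exact hh.1 x u hxu
  refine ⟨fun x u hxu => ?_, le_trans ?_ hh.2⟩
  · by_cases hx : x ∈ V0
    · exact hadj x u hx hxu
    · rw [abs_sub_comm]
      exact hadj u x ((mem_iff_not_mem_of_adj hexp hxu.symm).2 hx) hxu.symm
  · norm_cast
    refine Finset.card_le_card fun x hx => ?_
    rw [Finset.mem_filter] at hx ⊢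
    refine ⟨hx.1, fun hx0 => hx.2 ?_⟩
    have hxN : x ∉ nbhd G A := fun h' =>
      (mem_right_iff hexp).1 (nbhd_subset hexp peak_subset h') hx.1
    have hxr : x ∉ rim G A := fun h' => hxN (Finset.filter_subset _ _ h')
    unfold flatten
    rw [if_neg hxr, if_neg hxN, hx0, ite_self]

open Classical in
/-- Flattening a prescribed peak gains a free sign for each vertex of its rim. -/
theorem two_pow_card_rim_mul_card_le (hexp : IsBiExpander G V0 V1 n d lam) (hG : G.Connected)
    (hq : 2 * q < V0.card) (S : Finset (V × ℤ)) :
    2 ^ (rim G (S.image Prod.fst)).card *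
      ((finite_flatSet hG hq).toFinset.filter fun h => 2 ≤ h v ∧ peakGraph G V0 h v = S).card ≤
      (flatSet G V0 q).ncard := by
  set A := S.image Prod.fst with hA
  have hex : ∀ u, ∃ x, u ∈ nbhd G A → x ∈ A ∧ G.Adj x u := fun u => by
    by_cases hu : u ∈ nbhd G A
    · obtain ⟨x, hx⟩ := mem_nbhd.1 hu
      exact ⟨x, fun _ => hx⟩
    · exact ⟨u, fun h' => absurd h' hu⟩
  choose w hw using hex
  rw [← Finset.card_powerset, ← Finset.card_product,
    Set.ncard_eq_toFinset_card _ (finite_flatSet hG hq)]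
  have hmem : ∀ p ∈ (rim G A).powerset ×ˢ ((finite_flatSet hG hq).toFinset.filter fun h =>
      2 ≤ h v ∧ peakGraph G V0 h v = S), p.1 ⊆ rim G A ∧ p.2 ∈ flatSet G V0 q ∧ 2 ≤ p.2 v ∧
        peak G V0 p.2 v = A ∧ ∀ x ∈ A, (x, p.2 x) ∈ S := by
    rintro ⟨T, h⟩ hp
    simp only [Finset.mem_product, Finset.mem_powerset, Finset.mem_filter,
      Set.Finite.mem_toFinset] at hp
    obtain ⟨hT, hh, hv, hS⟩ := hp
    have hpeak : peak G V0 h v = A := by rw [← image_fst_peakGraph, hS]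
    refine ⟨hT, hh, hv, hpeak, fun x hx => ?_⟩
    rw [← hS]
    exact mem_peakGraph_iff.2 ⟨by rwa [hpeak], rfl⟩
  refine Finset.card_le_card_of_injOn (fun p => flatten G A w p.1 p.2) ?_ ?_
  · intro p hp
    obtain ⟨-, hh, hv, hpeak, -⟩ := hmem p hp
    have := flatten_mem_flatSet hexp hG hq hh hv (w := w)
      (fun u hu => (hw u (by rwa [hpeak] at hu)).2) p.1
    rw [hpeak] at this
    simpa using this
  · intro p hp p' hp' heq
    have hpS := (Finset.mem_filter.1 (Finset.mem_product.1 hp).2).2.2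
    obtain ⟨hT, hh, hv, hpeak, -⟩ := hmem p hp
    obtain ⟨hT', hh', hv', hpeak', hSA'⟩ := hmem p' hp'
    have hAeq : ∀ x ∈ A, p.2 x = p'.2 x := by
      intro x hx
      have := hSA' x hx
      rw [← hpS] at this
      exact (mem_peakGraph_iff.1 this).2
    have hnot : ∀ u ∈ nbhd G A, u ∉ A := fun u hu => by
      rw [← hpeak] at hu ⊢
      exact notMem_peak_of_mem_nbhd hexp hu
    have hrim : ∀ u ∈ rim G A, u ∈ nbhd G A := fun u hu => Finset.filter_subset _ _ hu
    refine Prod.ext ?_ ?_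
    · ext u
      by_cases hu : u ∈ rim G A
      · have := congrFun heq u
        simp only [flatten, if_neg (hnot u (hrim u hu)), if_pos hu] at this
        split_ifs at this <;> simp_all
      · exact iff_of_false (fun h' => hu (hT h')) fun h' => hu (hT' h')
    · funext u
      by_cases huA : u ∈ A
      · exact hAeq u huA
      by_cases hur : u ∈ rim G A
      · rw [eq_one_of_mem_rim_peak hexp hG hq hh hv (by rwa [hpeak]),
          eq_one_of_mem_rim_peak hexp hG hq hh' hv' (by rwa [hpeak'])]
      have := congrFun heq u
      by_cases huN : u ∈ nbhd G A
      · simp only [flatten, if_neg huA, if_neg hur, if_pos huN, hAeq _ (hw u huN).1] at this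
        omega
      · simpa only [flatten, if_neg huA, if_neg hur, if_neg huN] using this

end Switch

section Tail

theorem pow_le_two_pow_of_le_mul_log {d a r : ℕ} (hd : 2 ≤ d)
    (h : 75 * Real.log d * a ≤ r + a) : d ^ (50 * a) ≤ 2 ^ r := by
  have hd0 : (0 : ℝ) < d := by positivity
  have hlog2 : 0.6931471803 < Real.log 2 := Real.log_two_gt_d9
  have hlogd : Real.log 2 ≤ Real.log d := Real.log_le_log (by norm_num) (by exact_mod_cast hd)
  have key : ((d : ℝ) ^ (50 * a)) ≤ 2 ^ r := by
    rw [← Real.log_le_log_iff (by positivity) (by positivity), Real.log_pow, Real.log_pow]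
    push_cast
    have ha : (0 : ℝ) ≤ a := by positivity
    have h1 : Real.log 2 * (75 * Real.log d * a) ≤ Real.log 2 * (r + a) := by gcongr
    have h2 : 0.69 * (75 * Real.log d * a) ≤ Real.log 2 * (75 * Real.log d * a) := by
      have : 0 ≤ Real.log d * a := by
        have : 0 ≤ Real.log d := by linarith
        positivity
      nlinarith
    have h3 : Real.log 2 * a ≤ Real.log d * a := by gcongr
    have h4 : 0 ≤ Real.log d * a := by
      have : 0 ≤ Real.log d := by linarith
      positivity
    nlinarith
  exact_mod_cast key

theorem card_peak_le {V : Type*} {G : SimpleGraph V} {V0 : Finset V} {v : V} {q : ℝ}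
    {h : V → ℤ} (hh : h ∈ flatSet G V0 q) (hv : 2 ≤ h v) :
    ((peak G V0 h v).card : ℝ) ≤ q := by
  refine le_trans ?_ hh.2
  norm_cast
  refine Finset.card_le_card fun x hx => Finset.mem_filter.2 ⟨peak_subset hx, ?_⟩
  have := two_le_of_mem_peak hv hx
  omega

variable {V : Type*} [Fintype V] [DecidableEq V] {G : SimpleGraph V} [DecidableRel G.Adj]
  {V0 V1 : Finset V} {n d : ℕ} {lam : ℝ} {v : V} {ε : ℝ}

open Classical in
theorem pow_mul_card_peakGraph_eq_le (hexp : IsBiExpander G V0 V1 n d lam) (hG : G.Connected)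
    (hn : 0 < n) (hd : 2 ≤ d) (hε : ε = 1 / (300 * Real.log d)) (hε8 : 8 * ε ≤ 1)
    (hlam : lam ≤ ε * d) (hq : 2 * (2 * ε * n) < V0.card) (S : Finset (V × ℤ)) :
    d ^ (50 * S.card) * ((finite_flatSet hG hq).toFinset.filter fun h =>
      2 ≤ h v ∧ peakGraph G V0 h v = S).card ≤ (flatSet G V0 (2 * ε * n)).ncard := by
  rcases ((finite_flatSet hG hq).toFinset.filter fun h =>
      2 ≤ h v ∧ peakGraph G V0 h v = S).eq_empty_or_nonempty with hemp | ⟨h, hmem⟩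
  · simp [hemp]
  refine le_trans (Nat.mul_le_mul_right _ ?_) (two_pow_card_rim_mul_card_le hexp hG hq S)
  simp only [Finset.mem_filter, Set.Finite.mem_toFinset] at hmem
  obtain ⟨hh, hv, rfl⟩ := hmem
  rw [image_fst_peakGraph, card_peakGraph]
  have hlogd : 0 < Real.log d := Real.log_pos (by exact_mod_cast hd)
  have hεpos : 0 < ε := by rw [hε]; positivity
  have h1 := card_le_mul_card_nbhd hexp hn (by omega) hεpos (by linarith) hlam peak_subset
    (card_peak_le hh hv)
  have h2 : ((nbhd G (peak G V0 h v)).card : ℝ) ≤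
      (rim G (peak G V0 h v)).card + (peak G V0 h v).card := by
    exact_mod_cast card_nbhd_le_card_rim_add (by omega) hexp.2.2.2.2.2.2.1 _
  refine pow_le_two_pow_of_le_mul_log hd (le_trans ?_ h2)
  have h3 : 4 * ε * (75 * Real.log d) = 1 := by
    rw [hε]
    field_simp
    norm_num
  have h4 : 0 < 75 * Real.log d := by positivity
  calc 75 * Real.log d * (peak G V0 h v).card
      ≤ 75 * Real.log d * (4 * ε * (nbhd G (peak G V0 h v)).card) := by gcongr
    _ = 4 * ε * (75 * Real.log d) * (nbhd G (peak G V0 h v)).card := by ring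
    _ = (nbhd G (peak G V0 h v)).card := by rw [h3, one_mul]

open Classical in
theorem pow_mul_card_peak_card_eq_le (hexp : IsBiExpander G V0 V1 n d lam) (hG : G.Connected)
    (hn : 0 < n) (hd : 2 ≤ d) (hε : ε = 1 / (300 * Real.log d)) (hε8 : 8 * ε ≤ 1)
    (hlam : lam ≤ ε * d) (hq : 2 * (2 * ε * n) < V0.card) (hv : v ∈ V0) (j : ℤ) (a : ℕ) :
    d ^ (40 * a) * ((finite_flatSet hG hq).toFinset.filter fun h =>
      2 ≤ h v ∧ h v = j ∧ (peak G V0 h v).card = a).card ≤ (flatSet G V0 (2 * ε * n)).ncard := by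
  set Ω := (finite_flatSet hG hq).toFinset with hΩ
  set M := (flatSet G V0 (2 * ε * n)).ncard
  set 𝒮 := (tourSupports (pairNbhd G) (2 * (a - 1)) (v, j)).filter fun S => S.card = a with h𝒮
  have hsub : (Ω.filter fun h => 2 ≤ h v ∧ h v = j ∧ (peak G V0 h v).card = a) ⊆
      𝒮.biUnion fun S => Ω.filter fun h => 2 ≤ h v ∧ peakGraph G V0 h v = S := by
    intro h hh
    rw [Finset.mem_filter] at hh
    obtain ⟨hh, h2, hj, ha⟩ := hh
    refine Finset.mem_biUnion.2 ⟨peakGraph G V0 h v, ?_, Finset.mem_filter.2 ⟨hh, h2, rfl⟩⟩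
    refine Finset.mem_filter.2 ⟨?_, by rw [card_peakGraph, ha]⟩
    rw [← ha, ← hj]
    exact peakGraph_mem_tourSupports ((Set.Finite.mem_toFinset _).1 hh).1 hv
  have h𝒮card : 𝒮.card ≤ d ^ (10 * a) := by
    calc 𝒮.card ≤ (5 * d ^ 2) ^ (2 * (a - 1)) :=
          (Finset.card_filter_le _ _).trans
            (card_tourSupports_le (card_pairNbhd_le hexp.2.2.2.2.2.2.1) _ _)
      _ ≤ (d ^ 3 * d ^ 2) ^ (2 * (a - 1)) := by
          have : 2 ^ 3 ≤ d ^ 3 := Nat.pow_le_pow_left hd 3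
          gcongr
          omega
      _ = d ^ (10 * (a - 1)) := by rw [← pow_add, ← pow_mul]; congr 1; ring
      _ ≤ d ^ (10 * a) := Nat.pow_le_pow_right (by omega) (by omega)
  have hdpos : 0 < d ^ (10 * a) := by positivity
  refine Nat.le_of_mul_le_mul_left ?_ hdpos
  calc d ^ (10 * a) * (d ^ (40 * a) *
        (Ω.filter fun h => 2 ≤ h v ∧ h v = j ∧ (peak G V0 h v).card = a).card)
      = d ^ (50 * a) * (Ω.filter fun h => 2 ≤ h v ∧ h v = j ∧ (peak G V0 h v).card = a).card := by
        rw [← mul_assoc, ← pow_add]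
        congr 2
        ring
    _ ≤ d ^ (50 * a) *
        ∑ S ∈ 𝒮, (Ω.filter fun h => 2 ≤ h v ∧ peakGraph G V0 h v = S).card :=
        Nat.mul_le_mul_left _ ((Finset.card_le_card hsub).trans Finset.card_biUnion_le)
    _ = ∑ S ∈ 𝒮, d ^ (50 * S.card) *
        (Ω.filter fun h => 2 ≤ h v ∧ peakGraph G V0 h v = S).card := by
        rw [Finset.mul_sum]
        exact Finset.sum_congr rfl fun S hS => by rw [(Finset.mem_filter.1 hS).2]
    _ ≤ ∑ S ∈ 𝒮, M := Finset.sum_le_sum fun S _ =>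
        pow_mul_card_peakGraph_eq_le hexp hG hn hd hε hε8 hlam hq S
    _ = 𝒮.card * M := by simp
    _ ≤ d ^ (10 * a) * M := Nat.mul_le_mul_right _ h𝒮card

/-- Flat homomorphisms rarely rise to height `2 * (k + 1)` at a given vertex. -/
theorem pow_mul_ncard_high_le (hexp : IsBiExpander G V0 V1 n d lam) (hG : G.Connected)
    (hn : 0 < n) (hd : 2 ≤ d) (hε : ε = 1 / (300 * Real.log d)) (hε8 : 8 * ε ≤ 1)
    (hlam : lam ≤ ε * d) (v₀ : V) (hv : v ∈ V0) {k : ℕ} (hk : n ≤ 2 ^ (2 * 2 ^ k)) :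
    n ^ 20 * {h ∈ flatSet G V0 (2 * ε * n) | 2 * ((k : ℤ) + 1) ≤ h v}.ncard ≤
      (2 * n + 2) * (n + 1) * (HomSet G v₀).ncard := by
  classical
  have hnpos : (0 : ℝ) < n := by exact_mod_cast hn
  have hεpos : 0 < ε := by
    have : 0 < Real.log d := Real.log_pos (by exact_mod_cast hd)
    rw [hε]
    positivity
  have hq : 2 * (2 * ε * n) < V0.card := by
    rw [hexp.2.1]
    nlinarith
  set Ω := (finite_flatSet hG hq).toFinset with hΩ
  set M := (flatSet G V0 (2 * ε * n)).ncard
  set 𝓘 := Finset.Icc (0 : ℤ) (2 * n + 1) ×ˢ (Finset.range (n + 1)).filter fun a => 2 ^ k ≤ a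
  have hset : {h ∈ flatSet G V0 (2 * ε * n) | 2 * ((k : ℤ) + 1) ≤ h v} =
      (Ω.filter fun h => 2 * ((k : ℤ) + 1) ≤ h v : Finset (V → ℤ)) := by
    ext h
    simp [hΩ]
  have hsub : (Ω.filter fun h => 2 * ((k : ℤ) + 1) ≤ h v) ⊆ 𝓘.biUnion fun p =>
      Ω.filter fun h => 2 ≤ h v ∧ h v = p.1 ∧ (peak G V0 h v).card = p.2 := by
    intro h hh
    rw [Finset.mem_filter] at hh
    obtain ⟨hh, hkh⟩ := hh
    have hflat := (Set.Finite.mem_toFinset _).1 hh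
    have h2 : 2 ≤ h v := by omega
    have hcard := card_peak_le hflat h2
    have hle : (peak G V0 h v).card ≤ n := by
      rw [← hexp.2.1]
      exact Finset.card_le_card peak_subset
    have hpow : ∀ i : ℕ, 2 * ((i : ℤ) + 1) ≤ h v → 2 ^ i ≤ (peak G V0 h v).card := fun i hi =>
      two_pow_le_card_peak hexp hn (by omega) hεpos hε8 hlam hflat.1 hcard hv hi
    have hheight : h v ≤ 2 * n + 1 := by
      by_contra! hgt
      have h1 := hpow n (by omega)
      have h2 := Nat.lt_two_pow_self (n := n)
      omega
    refine Finset.mem_biUnion.2 ⟨(h v, (peak G V0 h v).card), ?_,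
      Finset.mem_filter.2 ⟨hh, h2, rfl, rfl⟩⟩
    simp only [𝓘, Finset.mem_product, Finset.mem_Icc, Finset.mem_filter, Finset.mem_range]
    exact ⟨⟨by omega, hheight⟩, by omega, hpow k hkh⟩
  have hterm : ∀ p ∈ 𝓘, n ^ 20 * (Ω.filter fun h =>
      2 ≤ h v ∧ h v = p.1 ∧ (peak G V0 h v).card = p.2).card ≤ M := by
    intro p hp
    refine le_trans (Nat.mul_le_mul_right _ ?_)
      (pow_mul_card_peak_card_eq_le hexp hG hn hd hε hε8 hlam hq hv p.1 p.2)
    have ha : 2 ^ k ≤ p.2 := (Finset.mem_filter.1 (Finset.mem_product.1 hp).2).2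
    calc n ^ 20 ≤ (2 ^ (2 * 2 ^ k)) ^ 20 := Nat.pow_le_pow_left hk 20
      _ = 2 ^ (40 * 2 ^ k) := by rw [← pow_mul]; congr 1; ring
      _ ≤ 2 ^ (40 * p.2) := Nat.pow_le_pow_right (by norm_num) (by omega)
      _ ≤ d ^ (40 * p.2) := Nat.pow_le_pow_left hd _
  have h𝓘 : 𝓘.card ≤ (2 * n + 2) * (n + 1) := by
    rw [Finset.card_product, Int.card_Icc]
    refine Nat.mul_le_mul (by omega) ((Finset.card_filter_le _ _).trans (by simp))
  rw [hset, Set.ncard_coe_finset]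
  calc n ^ 20 * (Ω.filter fun h => 2 * ((k : ℤ) + 1) ≤ h v).card
      ≤ n ^ 20 * ∑ p ∈ 𝓘, (Ω.filter fun h =>
          2 ≤ h v ∧ h v = p.1 ∧ (peak G V0 h v).card = p.2).card :=
        Nat.mul_le_mul_left _ ((Finset.card_le_card hsub).trans Finset.card_biUnion_le)
    _ ≤ ∑ p ∈ 𝓘, M := by
        rw [Finset.mul_sum]
        exact Finset.sum_le_sum hterm
    _ = 𝓘.card * M := by simp
    _ ≤ (2 * n + 2) * (n + 1) * (HomSet G v₀).ncard :=
        Nat.mul_le_mul h𝓘 (ncard_flatSet_le hG hq v₀)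

end Tail

section Upper

variable {V : Type*} [Fintype V] [DecidableEq V] {G : SimpleGraph V} [DecidableRel G.Adj]
  {V0 V1 : Finset V} {n d : ℕ} {lam : ℝ} {ε : ℝ}

/-- A vertex of a color class is almost as high as any given vertex. -/
theorem exists_mem_of_le (hexp : IsBiExpander G V0 V1 n d lam) (hd : 0 < d) {h : V → ℤ}
    (hh : IsIntHom G h) {v : V} {a : ℤ} (hv : a + 1 ≤ h v) : ∃ x ∈ V0, a ≤ h x := by
  by_cases hv0 : v ∈ V0
  · exact ⟨v, hv0, by omega⟩
  · obtain ⟨x, hx⟩ : (G.neighborFinset v).Nonempty := by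
      rw [← Finset.card_pos, SimpleGraph.card_neighborFinset_eq_degree, hexp.2.2.2.2.2.2.1]
      exact hd
    rw [SimpleGraph.mem_neighborFinset] at hx
    have := hh.cases hx
    exact ⟨x, (mem_iff_not_mem_of_adj hexp hx.symm).2 hv0, by omega⟩

/-- Large homomorphisms, normalized at their flat level and reflected if necessary, are high
somewhere on their flat class. -/
theorem exists_flat_high (hexp : IsBiExpander G V0 V1 n d lam) (hd : 0 < d) {f : V → ℤ} {v₀ : V}
    (hf : f ∈ HomSet G v₀) {q : ℝ} {m : ℤ} (hm : ((V0.filter fun x => f x ≠ m).card : ℝ) ≤ q)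
    {k : ℕ} {v : V} (hv : 4 * (k : ℤ) + 6 ≤ |f v|) :
    ∃ x ∈ V0, ∃ s ∈ ({1, -1} : Finset ℤ), ∃ h ∈ flatSet G V0 q,
      2 * ((k : ℤ) + 1) ≤ h x ∧ (fun u => s * (h u - h v₀)) = f := by
  obtain ⟨h0, hf⟩ := hf
  have hhom : IsIntHom G f := hf
  have hpos : (fun u => f u + -m) ∈ flatSet G V0 q := by
    refine ⟨hhom.add_const _, ?_⟩
    simpa [← sub_eq_add_neg, sub_eq_zero] using hm
  have hneg : (fun u => -(f u + -m)) ∈ flatSet G V0 q := by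
    refine ⟨hpos.1.neg, ?_⟩
    simpa only [ne_eq, neg_eq_zero] using hpos.2
  have hcase : (∃ u, 2 * ((k : ℤ) + 1) + 1 ≤ f u + -m) ∨
      ∃ u, 2 * ((k : ℤ) + 1) + 1 ≤ -(f u + -m) := by
    by_contra! hcon
    have h1 := hcon.1 v
    have h2 := hcon.1 v₀
    have h3 := hcon.2 v
    have h4 := hcon.2 v₀
    rcases le_abs.1 hv with h | h <;> omega
  rcases hcase with ⟨u, hu⟩ | ⟨u, hu⟩
  · obtain ⟨x, hx, hxh⟩ := exists_mem_of_le hexp hd hpos.1 hu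
    refine ⟨x, hx, 1, by simp, _, hpos, hxh, ?_⟩
    funext y
    simp [h0]
  · obtain ⟨x, hx, hxh⟩ := exists_mem_of_le hexp hd hneg.1 hu
    refine ⟨x, hx, -1, by simp, _, hneg, hxh, ?_⟩
    funext y
    simp [h0]

theorem ncard_large_le (hexp : IsBiExpander G V0 V1 n d lam) (hG : G.Connected)
    (hn : 3 ≤ n) (hd : 2 ≤ d) (hε : ε = 1 / (300 * Real.log d)) (hε8 : 8 * ε ≤ 1)
    (hlam : lam ≤ ε * d) (v₀ : V) {k : ℕ} (hk : n ≤ 2 ^ (2 * 2 ^ k)) :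
    2 * n ^ 2 * {f ∈ HomSet G v₀ | ∃ v, 4 * (k : ℤ) + 6 ≤ |f v|}.ncard ≤
      (HomSet G v₀).ncard := by
  classical
  have hnpos : (0 : ℝ) < n := by positivity
  have hεpos : 0 < ε := by
    have : 0 < Real.log d := Real.log_pos (by exact_mod_cast hd)
    rw [hε]
    positivity
  set U := {f ∈ HomSet G v₀ | ∃ v, 4 * (k : ℤ) + 6 ≤ |f v|} with hU
  set M := (HomSet G v₀).ncard
  set X : V → Finset V := fun x => if x ∈ V0 then V0 else V1 with hX
  set E : V × ℤ → Set (V → ℤ) := fun p => (fun (h : V → ℤ) u => p.2 * (h u - h v₀)) ''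
    {h ∈ flatSet G (X p.1) (2 * ε * n) | 2 * ((k : ℤ) + 1) ≤ h p.1} with hE
  have hXcases : ∀ x, ∃ Y, IsBiExpander G (X x) Y n d lam ∧ x ∈ X x := by
    intro x
    by_cases hx : x ∈ V0
    · refine ⟨V1, ?_⟩
      simp only [hX, if_pos hx]
      exact ⟨hexp, hx⟩
    · refine ⟨V0, ?_⟩
      simp only [hX, if_neg hx]
      exact ⟨isBiExpander_symm hexp, (mem_right_iff hexp).2 hx⟩
  have hfin : ∀ p : V × ℤ,
      {h ∈ flatSet G (X p.1) (2 * ε * n) | 2 * ((k : ℤ) + 1) ≤ h p.1}.Finite := by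
    intro p
    obtain ⟨Y, hY, -⟩ := hXcases p.1
    refine (finite_flatSet hG ?_).subset (Set.sep_subset _ _)
    rw [hY.2.1]
    nlinarith
  have hEcard : ∀ p, n ^ 20 * (E p).ncard ≤ (2 * n + 2) * (n + 1) * M := by
    intro p
    obtain ⟨Y, hY, hpX⟩ := hXcases p.1
    exact (Nat.mul_le_mul_left _ (Set.ncard_image_le (hfin p))).trans
      (pow_mul_ncard_high_le hY hG (by omega) hd hε hε8 hlam v₀ hpX hk)
  set I : Finset (V × ℤ) := Finset.univ ×ˢ {1, -1} with hI
  have hIcard : I.card = 4 * n := by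
    rw [hI, Finset.card_product, Finset.card_univ, hexp.1]
    simp
    ring
  have hsub : U ⊆ ⋃ p ∈ I, E p := by
    rintro f ⟨hf, v, hv⟩
    obtain ⟨Z, m, hZ, hm⟩ := exists_flat hexp hG (by omega) (by omega) hεpos (by linarith) hlam
      (f := f) hf.2
    have hZY : ∃ Y, IsBiExpander G Z Y n d lam ∧ ∀ x ∈ Z, X x = Z := by
      rcases hZ with rfl | rfl
      · exact ⟨V1, hexp, fun x hx => if_pos hx⟩
      · exact ⟨V0, isBiExpander_symm hexp, fun x hx => if_neg ((mem_right_iff hexp).1 hx)⟩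
    obtain ⟨Y, hY, hXZ⟩ := hZY
    obtain ⟨x, hx, s, hs, h, hh, hxh, hfh⟩ := exists_flat_high hY (by omega) hf hm hv
    simp only [Set.mem_iUnion]
    refine ⟨(x, s), Finset.mem_product.2 ⟨Finset.mem_univ _, hs⟩, h, ⟨?_, hxh⟩, hfh⟩
    simp only [hXZ x hx]
    exact hh
  have hUle : U.ncard ≤ ∑ p ∈ I, (E p).ncard :=
    (Set.ncard_le_ncard hsub (Set.Finite.biUnion I.finite_toSet fun p _ => (hfin p).image _)).trans
      (Finset.set_ncard_biUnion_le _ _)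
  have htotal : n ^ 20 * U.ncard ≤ 4 * n * ((2 * n + 2) * (n + 1) * M) := by
    calc n ^ 20 * U.ncard ≤ n ^ 20 * ∑ p ∈ I, (E p).ncard := Nat.mul_le_mul_left _ hUle
      _ ≤ ∑ p ∈ I, (2 * n + 2) * (n + 1) * M := by
        rw [Finset.mul_sum]
        exact Finset.sum_le_sum fun p _ => hEcard p
      _ = 4 * n * ((2 * n + 2) * (n + 1) * M) := by simp [hIcard]
  have hpoly : 4 * n * ((2 * n + 2) * (n + 1)) ≤ n ^ 7 := by
    have h1 : 2 * n + 2 ≤ n * n := by nlinarith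
    have h2 : n + 1 ≤ n * n := by nlinarith
    have h3 : 4 * n ≤ n * n * n := by nlinarith
    calc 4 * n * ((2 * n + 2) * (n + 1)) ≤ n * n * n * (n * n * (n * n)) := by gcongr
      _ = n ^ 7 := by ring
  have h13 : 2 * n ^ 2 ≤ n ^ 13 := by
    calc 2 * n ^ 2 ≤ n * n ^ 2 := by gcongr; omega
      _ = n ^ 3 := by ring
      _ ≤ n ^ 13 := Nat.pow_le_pow_right (by omega) (by norm_num)
  refine Nat.le_of_mul_le_mul_left ?_ (by positivity : 0 < n ^ 7)
  calc n ^ 7 * (2 * n ^ 2 * U.ncard) ≤ n ^ 7 * (n ^ 13 * U.ncard) := by gcongr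
    _ = n ^ 20 * U.ncard := by ring
    _ ≤ 4 * n * ((2 * n + 2) * (n + 1) * M) := htotal
    _ = 4 * n * ((2 * n + 2) * (n + 1)) * M := by ring
    _ ≤ n ^ 7 * M := by gcongr

end Upper

section Lower

variable {V : Type*} [Fintype V] {G : SimpleGraph V} [DecidableRel G.Adj]
  {V0 V1 : Finset V} {n d : ℕ} {lam : ℝ}

theorem isIntHom_sub_dist (hexp : IsBiExpander G V0 V1 n d lam) (hG : G.Connected) (t : ℤ)
    (z : V) : IsIntHom G fun u => t - G.dist u z := by
  intro u w huw
  obtain ⟨p, hp⟩ := hG.exists_walk_length_eq_dist u z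
  obtain ⟨p', hp'⟩ := hG.exists_walk_length_eq_dist w z
  have h1 := even_length_iff hexp p
  have h2 := even_length_iff hexp p'
  have h3 := mem_iff_not_mem_of_adj hexp huw
  have hne : ¬ (Even p.length ↔ Even p'.length) := by tauto
  rw [hp, hp', Nat.even_iff, Nat.even_iff] at hne
  have hle : G.dist u z ≤ G.dist w z + 1 := by
    rw [← hp']
    exact SimpleGraph.dist_le (p'.cons huw)
  have hle' : G.dist w z ≤ G.dist u z + 1 := by
    rw [← hp]
    exact SimpleGraph.dist_le (p.cons huw.symm)
  rw [abs_eq (by norm_num)]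
  beta_reduce
  omega

theorem IsIntHom.max {V : Type*} {G : SimpleGraph V} {f g : V → ℤ} (hf : IsIntHom G f) (hg : IsIntHom G g)
    (hfg : ∀ u, Even (f u - g u)) : IsIntHom G fun u => max (f u) (g u) := by
  intro u w huw
  have h1 := hf.cases huw
  have h2 := hg.cases huw
  have h3 := Int.even_iff.1 (hfg u)
  have h4 := Int.even_iff.1 (hfg w)
  rw [abs_eq (by norm_num)]
  beta_reduce
  omega

/-- A homomorphism below height `t` can be raised to height `t` precisely on a given set `J` of
vertices of the right parity, without changing it far from `J`. -/
theorem exists_raise [DecidableEq V] (hexp : IsBiExpander G V0 V1 n d lam) (hG : G.Connected)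
    {f : V → ℤ} (hf : IsIntHom G f) {t : ℕ} (hft : ∀ v, |f v| < t) (J : Finset V)
    (hJ : ∀ z ∈ J, Even (f z - t)) :
    ∃ g, IsIntHom G g ∧ (∀ u, Even (g u - f u)) ∧ (∀ u, f u ≤ g u) ∧
      (∀ u, g u = f u ∨ ∃ z ∈ J, G.dist u z < 2 * t) ∧ ∀ u, (t : ℤ) ≤ g u ↔ u ∈ J := by
  induction J using Finset.induction_on with
  | empty =>
    refine ⟨f, hf, by simp, by simp, by simp, fun u => ?_⟩
    have := (abs_lt.1 (hft u)).2
    simp only [Finset.notMem_empty, iff_false]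
    omega
  | insert z J hzJ ih =>
    obtain ⟨g, hg, hpar, hle, hfar, hhigh⟩ := ih fun x hx => hJ x (Finset.mem_insert_of_mem hx)
    have he := isIntHom_sub_dist hexp hG t z
    have hge : ∀ u, Even (g u - ((t : ℤ) - G.dist u z)) := by
      intro u
      have h1 : Even (f u - f z) ↔ Even (((t : ℤ) - G.dist u z) - (t - G.dist z z)) :=
        (even_sub_iff hexp hG hf u z).trans (even_sub_iff hexp hG he u z).symm
      have h2 := hJ z (Finset.mem_insert_self _ _)
      have h3 := hpar u
      simp only [SimpleGraph.dist_self, Nat.cast_zero, sub_zero] at h1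
      simp only [Int.even_iff] at *
      omega
    refine ⟨fun u => max (g u) (t - G.dist u z), hg.max he hge, fun u => ?_, fun u => ?_,
      fun u => ?_, fun u => ?_⟩
    · have h1 := hpar u
      have h2 := hge u
      beta_reduce
      rw [Int.even_iff] at *
      omega
    · exact (hle u).trans (le_max_left _ _)
    · have h1 := (abs_lt.1 (hft u)).1
      have h2 := hle u
      by_cases hd : G.dist u z < 2 * t
      · exact .inr ⟨z, Finset.mem_insert_self _ _, hd⟩
      · rcases hfar u with h | ⟨x, hx, h⟩
        · left
          simp only
          omega
        · exact .inr ⟨x, Finset.mem_insert_of_mem hx, h⟩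
    · have h0 : u = z ↔ G.dist u z = 0 := (hG.dist_eq_zero_iff).symm
      rw [Finset.mem_insert, ← hhigh u, h0, le_max_iff]
      omega

theorem card_dist_le [DecidableEq V] (hG : G.Connected) (hdeg : ∀ v, G.degree v = d) (z : V)
    (r : ℕ) : (Finset.univ.filter fun u => G.dist u z ≤ r).card ≤ (d + 1) ^ r := by
  induction r with
  | zero =>
    have : (Finset.univ.filter fun u => G.dist u z ≤ 0) = {z} := by
      ext u
      simp [hG.dist_eq_zero_iff]
    rw [this]
    simp
  | succ r ih =>
    set B := Finset.univ.filter fun u => G.dist u z ≤ r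
    have hsub : (Finset.univ.filter fun u => G.dist u z ≤ r + 1) ⊆ B ∪ nbhd G B := by
      intro u hu
      have hu := (Finset.mem_filter.1 hu).2
      obtain ⟨p, hp⟩ := hG.exists_walk_length_eq_dist u z
      cases p with
      | nil => simp [B]
      | cons huw p =>
        rename_i w
        refine Finset.mem_union_right _ (mem_nbhd.2 ⟨w, ?_, huw.symm⟩)
        have := SimpleGraph.dist_le p
        rw [SimpleGraph.Walk.length_cons] at hp
        exact Finset.mem_filter.2 ⟨Finset.mem_univ _, by omega⟩
    calc _ ≤ B.card + (nbhd G B).card := (Finset.card_le_card hsub).trans (Finset.card_union_le _ _)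
      _ ≤ B.card + B.card * d := Nat.add_le_add_left (card_nbhd_le hdeg B) _
      _ = B.card * (d + 1) := by ring
      _ ≤ (d + 1) ^ r * (d + 1) := Nat.mul_le_mul_right _ ih
      _ = (d + 1) ^ (r + 1) := by ring

/-- Vertices at distance less than `2 * t` from `J`. -/
noncomputable def near (G : SimpleGraph V) (J : Finset V) (t : ℕ) : Finset V :=
  Finset.univ.filter fun u => ∃ z ∈ J, G.dist u z < 2 * t

theorem card_near_le [DecidableEq V] (hG : G.Connected) (hdeg : ∀ v, G.degree v = d) (J : Finset V)
    (t : ℕ) : (near G J t).card ≤ J.card * (d + 1) ^ (2 * t) := by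
  have hsub : near G J t ⊆ J.biUnion fun z => Finset.univ.filter fun u => G.dist u z ≤ 2 * t := by
    intro u hu
    obtain ⟨z, hz, huz⟩ := (Finset.mem_filter.1 hu).2
    exact Finset.mem_biUnion.2 ⟨z, hz, Finset.mem_filter.2 ⟨Finset.mem_univ _, huz.le⟩⟩
  exact (Finset.card_le_card hsub).trans
    (Finset.card_biUnion_le_card_mul _ _ _ fun z _ => card_dist_le hG hdeg z _)

/-- Homomorphisms below height `t` are recovered from their raised versions and their values
near `J`. -/
theorem card_small_le [DecidableEq V] (hexp : IsBiExpander G V0 V1 n d lam) (hG : G.Connected)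
    (v₀ : V) (t : ℕ) (J : Finset V) (hJ : ∀ z ∈ J, ∀ f ∈ HomSet G v₀, Even (f z - t))
    (hfar : ∀ z ∈ J, 2 * t ≤ G.dist v₀ z) :
    ((finite_homSet hG v₀).toFinset.filter fun f : V → ℤ => ∀ v, |f v| < (t : ℤ)).card ≤
      ((finite_homSet hG v₀).toFinset.filter fun g =>
        (Finset.univ.filter fun u => (t : ℤ) ≤ g u) = J).card *
        (2 * t + 1) ^ (J.card * (d + 1) ^ (2 * t)) := by
  set H := (finite_homSet hG v₀).toFinset
  have hex : ∀ f : V → ℤ, ∃ g : V → ℤ, f ∈ H.filter (fun f : V → ℤ => ∀ v, |f v| < (t : ℤ)) →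
      g ∈ H ∧ (∀ u, g u = f u ∨ u ∈ near G J t) ∧ ∀ u, (t : ℤ) ≤ g u ↔ u ∈ J := by
    intro f
    by_cases hf : f ∈ H.filter fun f : V → ℤ => ∀ v, |f v| < (t : ℤ)
    · obtain ⟨hf, hft⟩ := Finset.mem_filter.1 hf
      rw [Set.Finite.mem_toFinset] at hf
      obtain ⟨g, hg, -, -, hgf, hhigh⟩ :=
        exists_raise hexp hG hf.2 hft J fun z hz => hJ z hz f hf
      refine ⟨g, fun _ => ⟨?_, fun u => (hgf u).imp_right fun h =>
        Finset.mem_filter.2 ⟨Finset.mem_univ _, h⟩, hhigh⟩⟩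
      rw [Set.Finite.mem_toFinset]
      refine ⟨?_, hg⟩
      rcases hgf v₀ with h | ⟨z, hz, h⟩
      · rw [h, hf.1]
      · have := hfar z hz
        omega
    · exact ⟨f, fun h => absurd h hf⟩
  choose raise hraise using hex
  set R : Finset (V → ℤ) := Fintype.piFinset fun u =>
    if u ∈ near G J t then Finset.Icc (-(t : ℤ)) t else {0} with hR
  have hRcard : R.card ≤ (2 * t + 1) ^ (J.card * (d + 1) ^ (2 * t)) := by
    have h1 : ∀ u, (if u ∈ near G J t then Finset.Icc (-(t : ℤ)) t else {0}).card =
        if u ∈ near G J t then 2 * t + 1 else 1 := by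
      intro u
      split_ifs
      · rw [Int.card_Icc]
        omega
      · simp
    rw [hR, Fintype.card_piFinset, Finset.prod_congr rfl fun u _ => h1 u, Finset.prod_ite_mem,
      Finset.univ_inter, Finset.prod_const]
    exact Nat.pow_le_pow_right (by omega) (card_near_le hG hexp.2.2.2.2.2.2.1 J t)
  refine le_trans ?_ (Nat.mul_le_mul_left _ hRcard)
  rw [← Finset.card_product]
  refine Finset.card_le_card_of_injOn
    (fun f => (raise f, fun u => if u ∈ near G J t then f u else 0)) ?_ ?_
  · intro f hf
    obtain ⟨hg, -, hhigh⟩ := hraise f hf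
    have hft := (Finset.mem_filter.1 hf).2
    refine Finset.mem_product.2 ⟨Finset.mem_filter.2 ⟨hg, ?_⟩, Fintype.mem_piFinset.2 fun u => ?_⟩
    · ext u
      simp [hhigh]
    · have := abs_lt.1 (hft u)
      by_cases hu : u ∈ near G J t
      · simp only [if_pos hu, Finset.mem_Icc]
        omega
      · simp [if_neg hu]
  · intro f hf f' hf' heq
    obtain ⟨h1, h2⟩ := Prod.ext_iff.1 heq
    funext u
    by_cases hu : u ∈ near G J t
    · simpa only [if_pos hu] using congrFun h2 u
    · rw [← ((hraise f hf).2.1 u).resolve_right hu, ← ((hraise f' hf').2.1 u).resolve_right hu]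
      exact congrFun h1 u

theorem choose_mul_ncard_small_le [DecidableEq V] (hexp : IsBiExpander G V0 V1 n d lam)
    (hG : G.Connected) (v₀ : V) (t : ℕ) :
    (n - (d + 1) ^ (2 * t)).choose 3 * {f ∈ HomSet G v₀ | ∀ v, |f v| < (t : ℤ)}.ncard ≤
      (HomSet G v₀).ncard * (2 * t + 1) ^ (3 * (d + 1) ^ (2 * t)) := by
  have hX : ∃ X : Finset V, X.card = n ∧ ∀ z ∈ X, ∀ f ∈ HomSet G v₀, Even (f z - t) := by
    have hpar : ∀ z, ∀ f ∈ HomSet G v₀, Even (f z) ↔ (z ∈ V0 ↔ v₀ ∈ V0) := by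
      intro z f hf
      rw [← even_sub_iff hexp hG hf.2 z v₀, hf.1, sub_zero]
    by_cases hcase : (v₀ ∈ V0 ↔ Even t)
    · refine ⟨V0, hexp.2.1, fun z hz f hf => ?_⟩
      rw [Int.even_sub, hpar z f hf, Int.even_coe_nat]
      tauto
    · refine ⟨V1, hexp.2.2.1, fun z hz f hf => ?_⟩
      rw [mem_right_iff hexp] at hz
      rw [Int.even_sub, hpar z f hf, Int.even_coe_nat]
      tauto
  obtain ⟨X, hXcard, hX⟩ := hX
  set b := (d + 1) ^ (2 * t) with hb
  set H := (finite_homSet hG v₀).toFinset with hH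
  set Z := X \ Finset.univ.filter fun u => G.dist u v₀ ≤ 2 * t with hZ
  have hZcard : n - b ≤ Z.card := by
    have h1 := Finset.le_card_sdiff (Finset.univ.filter fun u => G.dist u v₀ ≤ 2 * t) X
    have h2 := card_dist_le hG hexp.2.2.2.2.2.2.1 v₀ (2 * t)
    refine le_trans ?_ h1
    omega
  have hset : {f ∈ HomSet G v₀ | ∀ v, |f v| < (t : ℤ)} =
      (H.filter fun f => ∀ v, |f v| < (t : ℤ) : Finset (V → ℤ)) := by
    ext f
    simp [hH]
  rw [hset, Set.ncard_coe_finset, Set.ncard_eq_toFinset_card _ (finite_homSet hG v₀)]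
  calc (n - b).choose 3 * (H.filter fun f => ∀ v, |f v| < (t : ℤ)).card
      ≤ Z.card.choose 3 * (H.filter fun f => ∀ v, |f v| < (t : ℤ)).card :=
        Nat.mul_le_mul_right _ (Nat.choose_le_choose 3 hZcard)
    _ = ∑ J ∈ Z.powersetCard 3, (H.filter fun f => ∀ v, |f v| < (t : ℤ)).card := by simp
    _ ≤ ∑ J ∈ Z.powersetCard 3, (H.filter fun g =>
          (Finset.univ.filter fun u => (t : ℤ) ≤ g u) = J).card * (2 * t + 1) ^ (3 * b) := by
        refine Finset.sum_le_sum fun J hJ => ?_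
        obtain ⟨hJZ, hJ3⟩ := Finset.mem_powersetCard.1 hJ
        have := card_small_le hexp hG v₀ t J
          (fun z hz => hX z (Finset.mem_sdiff.1 (hJZ hz)).1) fun z hz => by
            have := (Finset.mem_sdiff.1 (hJZ hz)).2
            rw [Finset.mem_filter, SimpleGraph.dist_comm] at this
            simp only [Finset.mem_univ, true_and] at this
            omega
        rwa [hJ3] at this
    _ = (H.filter fun g => (Finset.univ.filter fun u => (t : ℤ) ≤ g u) ∈ Z.powersetCard 3).card *
          (2 * t + 1) ^ (3 * b) := by
        rw [← Finset.sum_mul, Finset.sum_card_fiberwise_eq_card_filter]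
    _ ≤ H.card * (2 * t + 1) ^ (3 * b) :=
        Nat.mul_le_mul_right _ (Finset.card_filter_le _ _)

theorem ncard_small_le [DecidableEq V] (hexp : IsBiExpander G V0 V1 n d lam) (hG : G.Connected)
    (v₀ : V) {t : ℕ} (ht : 1 ≤ t) (hn : ((2 * t + 1) ^ (3 * (d + 1) ^ (2 * t))) ^ 4 ≤ n) :
    2 * n ^ 2 * {f ∈ HomSet G v₀ | ∀ v, |f v| < (t : ℤ)}.ncard ≤ (HomSet G v₀).ncard := by
  have key := choose_mul_ncard_small_le hexp hG v₀ t
  set b := (d + 1) ^ (2 * t) with hb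
  set Q := (2 * t + 1) ^ (3 * b) with hQ
  set A := {f ∈ HomSet G v₀ | ∀ v, |f v| < (t : ℤ)}.ncard
  set M := (HomSet G v₀).ncard
  have hbpos : 1 ≤ b := Nat.one_le_pow _ _ (by omega)
  have hbQ : b < Q := by
    calc b < 2 ^ b := Nat.lt_two_pow_self
      _ ≤ (2 * t + 1) ^ b := Nat.pow_le_pow_left (by omega) _
      _ ≤ Q := Nat.pow_le_pow_right (by omega) (by omega)
  have hQ27 : 27 ≤ Q := by
    calc 27 = 3 ^ 3 := by norm_num
      _ ≤ (2 * t + 1) ^ 3 := Nat.pow_le_pow_left (by omega) _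
      _ ≤ Q := Nat.pow_le_pow_right (by omega) (by omega)
  have hnQ : 96 * Q ≤ n := by
    refine le_trans ?_ hn
    calc 96 * Q ≤ (27 * 27 * 27) * Q := by omega
      _ ≤ (Q * Q * Q) * Q := by gcongr
      _ = Q ^ 4 := by ring
  have hchoose : 2 * n ^ 2 * Q ≤ (n - b).choose 3 := by
    have h1 := Nat.pow_sub_le_descFactorial (n - b) 3
    rw [Nat.descFactorial_eq_factorial_mul_choose] at h1
    have h2 : n ≤ 2 * (n - b + 1 - 3) := by omega
    have h3 : n ^ 3 ≤ (2 * (n - b + 1 - 3)) ^ 3 := Nat.pow_le_pow_left h2 3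
    have h4 : 96 * Q * n ^ 2 ≤ n ^ 3 := by
      calc 96 * Q * n ^ 2 ≤ n * n ^ 2 := Nat.mul_le_mul_right _ hnQ
        _ = n ^ 3 := by ring
    rw [mul_pow] at h3
    norm_num [Nat.factorial] at h1 h3
    nlinarith
  refine Nat.le_of_mul_le_mul_right ?_ (by omega : 0 < Q)
  calc 2 * n ^ 2 * A * Q = 2 * n ^ 2 * Q * A := by ring
    _ ≤ (n - b).choose 3 * A := Nat.mul_le_mul_right _ hchoose
    _ ≤ M * Q := key

end Lower

section Numeric

open Real

theorem log_log_three_pos : 0 < log (log 3) := by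
  refine log_pos ?_
  rw [lt_log_iff_exp_lt (by norm_num)]
  exact exp_one_lt_three

theorem log_log_three_le {n : ℕ} (hn : 3 ≤ n) : log (log 3) ≤ log (log n) := by
  have h3 : (3 : ℝ) ≤ n := by exact_mod_cast hn
  exact log_le_log (log_pos (by norm_num)) (log_le_log (by norm_num) h3)

theorem le_two_pow_two_pow {n k : ℕ} (hn : 3 ≤ n) (hk : 2 * log (log n) ≤ k) :
    n ≤ 2 ^ (2 * 2 ^ k) := by
  have hn0 : (0 : ℝ) < n := by positivity
  have hlog : 0 < log n := log_pos (by exact_mod_cast (by omega : 1 < n))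
  have hL : 0 < log (log n) := log_log_three_pos.trans_le (log_log_three_le hn)
  have h2 : (1 / 2 : ℝ) ≤ log 2 := by linarith [log_two_gt_d9]
  have h1 : log n ≤ 2 ^ k := by
    rw [← log_le_log_iff hlog (by positivity), log_pow]
    nlinarith
  have h3 : log n ≤ log ((2 : ℝ) ^ (2 * 2 ^ k)) := by
    rw [log_pow]
    push_cast
    nlinarith
  exact_mod_cast (log_le_log_iff hn0 (by positivity)).1 h3

theorem pow_four_le {D n t : ℕ} (hD : 3 ≤ D) (hn : 3 ≤ n)
    (hL : 2 * log (24 * (D : ℝ) ^ 3) ≤ log (log n))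
    (ht : (t : ℝ) ≤ 1 / (2 * log (24 * (D : ℝ) ^ 3)) * log (log n) + 1) :
    ((2 * t + 1) ^ (3 * D ^ (2 * t))) ^ 4 ≤ n := by
  have hn0 : (0 : ℝ) < n := by positivity
  have hlog : 0 < log n := log_pos (by exact_mod_cast (by omega : 1 < n))
  have hD3 : (3 : ℝ) ≤ D := by exact_mod_cast hD
  have hlogD : 0 < log D := log_pos (by linarith)
  set L := log (log n) with hLdef
  have hE : log (24 * (D : ℝ) ^ 3) = log 24 + 3 * log D := by
    rw [log_mul (by norm_num) (by positivity), log_pow]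
    norm_num
  have h24 : 0 < log (24 : ℝ) := log_pos (by norm_num)
  set E := log (24 * (D : ℝ) ^ 3) with hEdef
  have hEpos : 0 < E := by rw [hE]; positivity
  have hbound : (D : ℝ) ^ (3 * t) * 24 ≤ log n := by
    rw [← log_le_log_iff (by positivity) hlog, log_mul (by positivity) (by norm_num), log_pow]
    push_cast
    have h1 : 1 / (2 * E) * L * (3 * log D) ≤ L / 2 := by
      have : 1 / (2 * E) * L * (3 * log D) = (3 * log D / E) * (L / 2) := by
        field_simp
      rw [this]
      refine mul_le_of_le_one_left (by linarith) ?_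
      rw [div_le_one hEpos]
      linarith
    have h2 : (t : ℝ) * (3 * log D) ≤ (1 / (2 * E) * L + 1) * (3 * log D) :=
      mul_le_mul_of_nonneg_right ht (by positivity)
    linarith
  have htD : (t : ℝ) ≤ (D : ℝ) ^ t := by
    exact_mod_cast (Nat.lt_pow_self (by omega : 1 < D)).le
  have hlogt : log (2 * t + 1 : ℝ) ≤ 2 * D ^ t := by
    have := log_le_sub_one_of_pos (by positivity : (0 : ℝ) < 2 * t + 1)
    linarith
  have key : log ((((2 * t + 1) ^ (3 * D ^ (2 * t))) ^ 4 : ℕ) : ℝ) ≤ log n := by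
    push_cast
    rw [log_pow, log_pow]
    push_cast
    calc (4 : ℝ) * (3 * D ^ (2 * t) * log (2 * t + 1))
        ≤ 4 * (3 * D ^ (2 * t) * (2 * D ^ t)) := by gcongr
      _ = D ^ (3 * t) * 24 := by ring
      _ ≤ log n := hbound
  exact_mod_cast (log_le_log_iff (by positivity) hn0).1 key

end Numeric

section Degree

variable {V : Type*} [Fintype V] {G : SimpleGraph V} [DecidableRel G.Adj]
  {V0 V1 : Finset V} {n d : ℕ} {lam : ℝ}

theorem exists_adj (hexp : IsBiExpander G V0 V1 n d lam) (hG : G.Connected) (hn : 3 ≤ n) (v : V) :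
    ∃ u, G.Adj v u := by
  have : Nontrivial V := Fintype.one_lt_card_iff_nontrivial.1 (by rw [hexp.1]; omega)
  exact hG.preconnected.exists_adj_of_nontrivial v

theorem two_le_degree (hexp : IsBiExpander G V0 V1 n d lam) (hG : G.Connected) (hn : 3 ≤ n)
    (hlam : lam ≤ (d : ℝ) / (300 * Real.log d)) : 2 ≤ d := by
  obtain ⟨u, hu⟩ := Finset.card_pos.1 (by rw [hexp.2.1]; omega : 0 < V0.card)
  obtain ⟨w, hw⟩ := exists_adj hexp hG hn u
  have hd0 : d ≠ 0 := by
    rw [← hexp.2.2.2.2.2.2.1 u]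
    exact ((G.degree_pos_iff_exists_adj u).2 ⟨w, hw⟩).ne'
  by_contra! hd
  obtain rfl : d = 1 := by omega
  have hwV : w ∈ V1 := (mem_right_iff hexp).2 ((mem_iff_not_mem_of_adj hexp hw).1 hu)
  have h := hexp.2.2.2.2.2.2.2 {u} {w} (by simpa using hu) (by simpa using hwV)
  have he : edgeCount G {u} {w} = 1 := by
    simp [edgeCount, Finset.filter_singleton, hw]
  have hn3 : (3 : ℝ) ≤ n := by exact_mod_cast hn
  have hinv : (1 : ℝ) / n ≤ 1 / 3 := one_div_le_one_div_of_le (by norm_num) hn3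
  simp only [he, Finset.card_singleton, Nat.cast_one, mul_one, Real.sqrt_one] at h
  simp only [Nat.cast_one, Real.log_one, mul_zero, div_zero] at hlam
  linarith [le_abs_self (1 - 1 / (n : ℝ))]

theorem eight_mul_le {d : ℕ} (hd : 2 ≤ d) : 8 * (1 / (300 * Real.log d)) ≤ 1 := by
  have h2 : Real.log 2 ≤ Real.log d :=
    Real.log_le_log (by norm_num) (by exact_mod_cast hd)
  have := Real.log_two_gt_d9
  rw [mul_one_div, div_le_one (by linarith)]
  linarith

end Degree

section Main

variable {V : Type*} [Fintype V] [DecidableEq V] {G : SimpleGraph V} [DecidableRel G.Adj]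
  {V0 V1 : Finset V} {n d : ℕ} {lam : ℝ}

theorem ncard_exceeding_le (hexp : IsBiExpander G V0 V1 n d lam) (hG : G.Connected) (hn : 3 ≤ n)
    (hlam : lam ≤ (d : ℝ) / (300 * Real.log d)) (v₀ : V) :
    2 * n ^ 2 * {f ∈ HomSet G v₀ | ∃ v, (8 + 10 / Real.log (Real.log 3)) * Real.log (Real.log n) <
      (|f v| : ℤ)}.ncard ≤ (HomSet G v₀).ncard := by
  have hd := two_le_degree hexp hG hn hlam
  have hlam' : lam ≤ 1 / (300 * Real.log d) * d := by rwa [one_div_mul_eq_div]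
  set L := Real.log (Real.log n)
  have h3 := log_log_three_pos
  have hL : Real.log (Real.log 3) ≤ L := log_log_three_le hn
  have hk := le_two_pow_two_pow hn (Nat.le_ceil (2 * L))
  refine le_trans (Nat.mul_le_mul_left _ (Set.ncard_le_ncard ?_
    ((finite_homSet hG v₀).subset fun f hf => hf.1)))
    (ncard_large_le hexp hG hn hd rfl (eight_mul_le hd) hlam' v₀ hk)
  rintro f ⟨hf, v, hv⟩
  refine ⟨hf, v, ?_⟩
  have h1 : ((⌈2 * L⌉₊ : ℕ) : ℝ) < 2 * L + 1 := Nat.ceil_lt_add_one (by linarith)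
  have h2 : 10 ≤ 10 / Real.log (Real.log 3) * L := by
    rw [div_mul_eq_mul_div, le_div_iff₀ h3]
    linarith
  have h4 : ((4 * (⌈2 * L⌉₊ : ℤ) + 6 : ℤ) : ℝ) ≤ (|f v| : ℤ) := by
    push_cast at hv ⊢
    linarith
  exact_mod_cast h4

theorem ncard_below_le (hexp : IsBiExpander G V0 V1 n d lam) (hG : G.Connected) (hn : 3 ≤ n)
    (hd : 2 ≤ d) (v₀ : V) :
    2 * n ^ 2 * {f ∈ HomSet G v₀ | ∀ v, ((|f v| : ℤ) : ℝ) <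
      1 / (2 * Real.log (24 * ((d + 1 : ℕ) : ℝ) ^ 3)) * Real.log (Real.log n)}.ncard ≤
      (HomSet G v₀).ncard := by
  set L := Real.log (Real.log n)
  set E := Real.log (24 * ((d + 1 : ℕ) : ℝ) ^ 3)
  have hEpos : 0 < E := by
    refine Real.log_pos ?_
    have : (1 : ℝ) ≤ ((d + 1 : ℕ) : ℝ) ^ 3 := one_le_pow₀ (by simp)
    linarith
  have hLpos : 0 < L := log_log_three_pos.trans_le (log_log_three_le hn)
  rcases lt_or_ge L (2 * E) with hLE | hLE
  · have hempty : {f ∈ HomSet G v₀ | ∀ v, ((|f v| : ℤ) : ℝ) < 1 / (2 * E) * L} = ∅ := by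
      rw [Set.eq_empty_iff_forall_notMem]
      rintro f ⟨hf, hlt⟩
      obtain ⟨u, hu⟩ := exists_adj hexp hG hn v₀
      have h1 := hf.2 v₀ u hu
      rw [hf.1, zero_sub, abs_neg] at h1
      have h2 := hlt u
      rw [h1, one_div_mul_eq_div, lt_div_iff₀ (by positivity)] at h2
      push_cast at h2
      linarith
    rw [hempty, Set.ncard_empty, mul_zero]
    exact Nat.zero_le _
  · have hpos : 0 < 1 / (2 * E) * L := by positivity
    refine le_trans (Nat.mul_le_mul_left _ (Set.ncard_le_ncard ?_
      ((finite_homSet hG v₀).subset fun f hf => hf.1)))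
      (ncard_small_le hexp hG v₀ (t := ⌈1 / (2 * E) * L⌉₊) (Nat.ceil_pos.2 hpos)
        (pow_four_le (by omega) hn hLE (Nat.ceil_lt_add_one hpos.le).le))
    rintro f ⟨hf, hlt⟩
    refine ⟨hf, fun v => ?_⟩
    have h := (hlt v).trans_le (Nat.le_ceil _)
    exact_mod_cast h

/-- Discarding two exceptional sets of relative size at most `1 / (2 * n ^ 2)` each. -/
theorem one_sub_mul_ncard_le {α : Type*} {H A B T : Set α} (hH : H.Finite) {n : ℕ} (hn : 0 < n)
    (hA : 2 * n ^ 2 * A.ncard ≤ H.ncard) (hB : 2 * n ^ 2 * B.ncard ≤ H.ncard)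
    (hTH : T ⊆ H) (hAH : A ⊆ H) (hBH : B ⊆ H) (hcover : H ⊆ T ∪ (A ∪ B)) :
    (1 - 1 / (n : ℝ) ^ 2) * (H.ncard : ℝ) ≤ T.ncard := by
  have h1 : H.ncard ≤ T.ncard + (A.ncard + B.ncard) :=
    (Set.ncard_le_ncard hcover ((hH.subset hTH).union ((hH.subset hAH).union
      (hH.subset hBH)))).trans ((Set.ncard_union_le _ _).trans
        (Nat.add_le_add_left (Set.ncard_union_le _ _) _))
  have h1' : (H.ncard : ℝ) ≤ T.ncard + (A.ncard + B.ncard) := by exact_mod_cast h1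
  have hA' : 2 * (n : ℝ) ^ 2 * A.ncard ≤ H.ncard := by exact_mod_cast hA
  have hB' : 2 * (n : ℝ) ^ 2 * B.ncard ≤ H.ncard := by exact_mod_cast hB
  have hn2 : (0 : ℝ) < (n : ℝ) ^ 2 := by positivity
  have h2 : ((A.ncard : ℝ) + B.ncard) ≤ H.ncard / (n : ℝ) ^ 2 := by
    rw [le_div_iff₀ hn2]
    linarith
  rw [sub_mul, one_mul, one_div_mul_eq_div]
  linarith

end Main

end BiExpander

theorem stmt6 (d : ℕ) (lam : ℝ) (hlam : lam ≤ (d : ℝ) / (300 * Real.log d)) :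
    ∃ c C : ℝ, 0 < c ∧ 0 < C ∧
      ∀ (V : Type) [Fintype V] [DecidableEq V],
      ∀ (G : SimpleGraph V) [DecidableRel G.Adj],
      ∀ (V0 V1 : Finset V) (n : ℕ), 3 ≤ n → G.Connected →
        IsBiExpander G V0 V1 n d lam →
        ∀ v₀ : V,
          (1 - 1 / (n : ℝ) ^ 2) * ((HomSet G v₀).ncard : ℝ) ≤
            ({f ∈ HomSet G v₀ |
                (∃ v : V, c * Real.log (Real.log n) ≤ (|f v| : ℤ)) ∧
                (∀ v : V, ((|f v| : ℤ) : ℝ) ≤ C * Real.log (Real.log n))}.ncard : ℝ) := by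
  refine ⟨1 / (2 * Real.log (24 * ((d + 1 : ℕ) : ℝ) ^ 3)), 8 + 10 / Real.log (Real.log 3),
    ?_, ?_, ?_⟩
  · have : (1 : ℝ) ≤ ((d + 1 : ℕ) : ℝ) ^ 3 := one_le_pow₀ (by simp)
    have : 0 < Real.log (24 * ((d + 1 : ℕ) : ℝ) ^ 3) := Real.log_pos (by linarith)
    positivity
  · have := BiExpander.log_log_three_pos
    positivity
  intro V _ _ G _ V0 V1 n hn hG hexp v₀
  have hd := BiExpander.two_le_degree hexp hG hn hlam
  refine BiExpander.one_sub_mul_ncard_le (BiExpander.finite_homSet hG v₀) (by omega)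
    (BiExpander.ncard_exceeding_le hexp hG hn hlam v₀)
    (BiExpander.ncard_below_le hexp hG hn hd v₀)
    (fun f hf => hf.1) (fun f hf => hf.1) (fun f hf => hf.1) fun f hf => ?_
  by_cases hU : ∃ v, (8 + 10 / Real.log (Real.log 3)) * Real.log (Real.log n) < (|f v| : ℤ)
  · exact .inr (.inl ⟨hf, hU⟩)
  by_cases hW : ∀ v, ((|f v| : ℤ) : ℝ) <
      1 / (2 * Real.log (24 * ((d + 1 : ℕ) : ℝ) ^ 3)) * Real.log (Real.log n)
  · exact .inr (.inr ⟨hf, hW⟩)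
  push Not at hU hW
  exact .inl ⟨hf, hW, hU⟩
end

section
/- Let a be a positive integer, let H be a finite simple graph with maximum degree Δ ≥ 1, and let v be a vertex of H. Then the number of vertex sets A ⊆ V(H) such that v ∈ A, |A| = a, and the subgraph of H induced by A is connected, is at most Δ^{2a−2}. -/
namespace SimpleGraph

variable {V : Type*} [DecidableEq V] {H : SimpleGraph V}

/-- At most `Δ ^ n` vertex sets are traced by walks of length `n` starting at `v`. -/
theorem ncard_walk_supports_le [Fintype V] [DecidableRel H.Adj] {Δ : ℕ}
    (hdeg : ∀ v : V, H.degree v ≤ Δ) (n : ℕ) (v : V) :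
    {s : Finset V | ∃ w, ∃ p : H.Walk v w, p.length = n ∧ p.support.toFinset = s}.ncard ≤
      Δ ^ n := by
  induction n generalizing v with
  | zero =>
    rw [pow_zero, Set.ncard_le_one_iff]
    rintro s t ⟨w, p, hp, rfl⟩ ⟨x, q, hq, rfl⟩
    cases p with
    | nil =>
      cases q with
      | nil => rfl
      | cons h q => simp at hq
    | cons h p => simp at hp
  | succ n ih =>
    have hsub : {s : Finset V | ∃ w, ∃ p : H.Walk v w,
          p.length = n + 1 ∧ p.support.toFinset = s} ⊆
        ⋃ u ∈ H.neighborFinset v, insert v '' {s : Finset V | ∃ w, ∃ p : H.Walk u w,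
          p.length = n ∧ p.support.toFinset = s} := by
      rintro s ⟨w, p, hp, rfl⟩
      cases p with
      | nil => simp at hp
      | @cons _ u _ h p =>
        simp only [Set.mem_iUnion]
        exact ⟨u, by simpa using h, p.support.toFinset, ⟨w, p, by simpa using hp, rfl⟩, by simp⟩
    calc _ ≤ _ := Set.ncard_le_ncard hsub (Set.toFinite _)
      _ ≤ _ := Finset.set_ncard_biUnion_le _ _
      _ ≤ ∑ u ∈ H.neighborFinset v, Δ ^ n :=
          Finset.sum_le_sum fun u _ => (Set.ncard_image_le (Set.toFinite _)).trans (ih u)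
      _ = H.degree v * Δ ^ n := by simp
      _ ≤ Δ * Δ ^ n := Nat.mul_le_mul_right _ (hdeg v)
      _ = Δ ^ (n + 1) := (pow_succ' _ _).symm

/-- A detour along an edge leaving the support extends a closed walk by one new vertex. -/
theorem Walk.exists_detour {v x y : V} (p : H.Walk v v) (hx : x ∈ p.support) (h : H.Adj x y) :
    ∃ q : H.Walk v v, q.length = p.length + 2 ∧
      q.support.toFinset = insert y p.support.toFinset := by
  refine ⟨(p.takeUntil x hx).append (.cons h (.cons h.symm (p.dropUntil x hx))), ?_, ?_⟩
  · have := congrArg Walk.length (p.take_spec hx)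
    simp only [Walk.length_append, Walk.length_cons] at this ⊢
    omega
  · ext z
    have : z ∈ p.support ↔
        z ∈ (p.takeUntil x hx).support ∨ z ∈ (p.dropUntil x hx).support := by
      rw [← Walk.mem_support_append_iff, p.take_spec hx]
    have hxd : x ∈ (p.dropUntil x hx).support := Walk.start_mem_support _
    simp only [List.mem_toFinset, Finset.mem_insert, this, Walk.mem_support_append_iff,
      Walk.support_cons, List.mem_cons]
    grind

/-- A connected vertex set `A` contains closed walks of length `2 * k` visiting exactly `k + 1`
vertices, for every `k < #A`. -/
theorem exists_closed_walk_of_induce_connected {A : Finset V} {v : V} (hv : v ∈ A)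
    (hA : (H.induce (A : Set V)).Connected) (k : ℕ) (hk : k < A.card) :
    ∃ p : H.Walk v v, p.length = 2 * k ∧ p.support.toFinset ⊆ A ∧
      p.support.toFinset.card = k + 1 := by
  induction k with
  | zero => exact ⟨.nil, by simpa using hv⟩
  | succ k ih =>
    obtain ⟨p, hlen, hsub, hcard⟩ := ih (by omega)
    obtain ⟨z, hzA, hz⟩ := Finset.exists_mem_notMem_of_card_lt_card (hcard ▸ hk)
    obtain ⟨w⟩ := hA.preconnected ⟨v, hv⟩ ⟨z, hzA⟩
    obtain ⟨d, -, hd, hd'⟩ := w.exists_boundary_dart {x | (x : V) ∈ p.support}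
      p.start_mem_support (by simpa using hz)
    obtain ⟨q, hq, hqs⟩ := p.exists_detour hd d.adj
    refine ⟨q, by omega, ?_, ?_⟩
    · rw [hqs]
      exact Finset.insert_subset d.snd.2 hsub
    · rw [hqs, Finset.card_insert_of_notMem (by simpa using hd'), hcard]

end SimpleGraph

theorem stmt8 {V : Type*} [Fintype V] [DecidableEq V]
    (H : SimpleGraph V) [DecidableRel H.Adj]
    (Δ a : ℕ) (ha : 0 < a) (hΔ : 1 ≤ Δ) (hdeg : ∀ v : V, H.degree v ≤ Δ) (v : V) :
    {A : Finset V | v ∈ A ∧ A.card = a ∧ (H.induce (A : Set V)).Connected}.ncard ≤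
      Δ ^ (2 * a - 2) := by
  refine (Set.ncard_le_ncard ?_ (Set.toFinite _)).trans
    (SimpleGraph.ncard_walk_supports_le hdeg (2 * a - 2) v)
  rintro A ⟨hv, rfl, hA⟩
  obtain ⟨p, hlen, hsub, hcard⟩ :=
    SimpleGraph.exists_closed_walk_of_induce_connected hv hA (A.card - 1) (by omega)
  exact ⟨v, p, by omega, Finset.eq_of_subset_of_card_le hsub (by omega)⟩
end

section
/- Let G be an n-vertex d-regular λ-expander with λ > 0. Then for every vertex set A ⊆ V(G), the neighborhood N(A) satisfies |N(A)| ≥ min{n/2, (d²/(4λ²))·|A|}. -/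
/-- `G` is an `n`-vertex `d`-regular `λ`-expander. -/
def IsExpander {V : Type*} [Fintype V] (G : SimpleGraph V) [DecidableRel G.Adj]
    (d : ℕ) (lam : ℝ) : Prop :=
  (∀ v : V, G.degree v = d) ∧
  ∀ S T : Finset V,
    |(edgeCount G S T : ℝ) - (d : ℝ) / (Fintype.card V : ℝ) * S.card * T.card| ≤
      lam * Real.sqrt ((S.card : ℝ) * T.card)

/-- The neighborhood of a vertex set `A`. -/
def nbr {V : Type*} [Fintype V] (G : SimpleGraph V) [DecidableRel G.Adj]
    (A : Finset V) : Finset V :=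
  Finset.univ.filter (fun b => ∃ a ∈ A, G.Adj a b)

/-- In a `d`-regular graph, every edge leaving `A` ends in the neighborhood of `A`. -/
theorem edgeCount_nbr {V : Type*} [Fintype V] (G : SimpleGraph V) [DecidableRel G.Adj]
    {d : ℕ} (hd : ∀ v : V, G.degree v = d) (A : Finset V) :
    edgeCount G A (nbr G A) = A.card * d := by
  rw [edgeCount, Finset.card_filter, Finset.sum_product, ← smul_eq_mul, ← Finset.sum_const]
  refine Finset.sum_congr rfl fun a ha => ?_
  rw [← Finset.card_filter, ← hd a, ← G.card_neighborFinset_eq_degree]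
  congr 1
  ext b
  simp only [nbr, Finset.mem_filter, Finset.mem_univ, true_and, SimpleGraph.mem_neighborFinset]
  exact ⟨fun h => h.2, fun h => ⟨⟨a, ha, h⟩, h⟩⟩

theorem stmt10 {V : Type*} [Fintype V] (G : SimpleGraph V) [DecidableRel G.Adj]
    (d : ℕ) (lam : ℝ) (hlam : 0 < lam) (hG : IsExpander G d lam) (A : Finset V) :
    min ((Fintype.card V : ℝ) / 2) ((d : ℝ) ^ 2 / (4 * lam ^ 2) * A.card) ≤
      ((nbr G A).card : ℝ) := by
  obtain ⟨hd, hexp⟩ := hG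
  rw [min_le_iff, or_iff_not_imp_left, not_le]
  intro hlt
  have h := (abs_le.1 (hexp A (nbr G A))).2
  rw [edgeCount_nbr G hd A] at h
  push_cast at h
  set n : ℝ := (Fintype.card V : ℝ)
  set N : ℝ := ((nbr G A).card : ℝ)
  set a : ℝ := (A.card : ℝ)
  have hN : 0 ≤ N := Nat.cast_nonneg _
  have ha : 0 ≤ a := Nat.cast_nonneg _
  have hn : 0 < n := by linarith
  rcases ha.eq_or_lt with ha0 | ha0
  · rw [← ha0, mul_zero]
    exact hN
  have hmain : (d : ℝ) / n * a * N ≤ d * a / 2 := by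
    calc (d : ℝ) / n * a * N ≤ d / n * a * (n / 2) := by gcongr
      _ = d * a / 2 := by field_simp
  have hsqrt : d * a / 2 ≤ lam * √(a * N) := by linarith
  have hsq : (d * a / 2) ^ 2 ≤ lam ^ 2 * (a * N) := by
    calc (d * a / 2) ^ 2 ≤ (lam * √(a * N)) ^ 2 := by gcongr
      _ = lam ^ 2 * (a * N) := by rw [mul_pow, Real.sq_sqrt (by positivity)]
  rw [div_mul_eq_mul_div, div_le_iff₀ (by positivity)]
  refine le_of_mul_le_mul_left ?_ ha0
  linarith
end

section
/- Let G be an n-vertex d-regular λ-expander with λ > 0. Then for every vertex set A ⊆ V(G) with |A| ≤ n/4, the outer boundary ∂(A) = N(A) \ A satisfies |∂(A)| ≥ min{n/4, (d²/(4λ²) − 1)·|A|}. -/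
/-- In an expander, a set whose neighborhood covers at most half of the vertices has a
neighborhood larger than itself by a factor of at least `d ^ 2 / (4 * lam ^ 2)`. -/
theorem IsExpander.le_card_nbr {V : Type*} [Fintype V] {G : SimpleGraph V} [DecidableRel G.Adj]
    {d : ℕ} {lam : ℝ} (hlam : 0 < lam) (hG : IsExpander G d lam) {A : Finset V}
    (hN : ((nbr G A).card : ℝ) ≤ (Fintype.card V : ℝ) / 2) :
    (d : ℝ) ^ 2 / (4 * lam ^ 2) * A.card ≤ ((nbr G A).card : ℝ) := by
  rcases A.eq_empty_or_nonempty with rfl | hne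
  · simp
  have ha : (0 : ℝ) < A.card := by exact_mod_cast hne.card_pos
  have hn : (0 : ℝ) < Fintype.card V := by
    exact_mod_cast hne.card_pos.trans_le A.card_le_univ
  have hmix := (le_abs_self _).trans (hG.2 A (nbr G A))
  rw [edgeCount_nbr G hG.1 A] at hmix
  push_cast at hmix
  set a : ℝ := (A.card : ℝ)
  set m : ℝ := ((nbr G A).card : ℝ)
  set n : ℝ := (Fintype.card V : ℝ)
  have hm : 0 ≤ m := Nat.cast_nonneg _
  have hhalf : (d : ℝ) / n * a * m ≤ a * d / 2 := by
    calc (d : ℝ) / n * a * m ≤ d / n * a * (n / 2) := by gcongr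
      _ = a * d / 2 := by field_simp
  have hroot : a * d / 2 ≤ lam * √(a * m) := by linarith
  have hsq : (a * d / 2) ^ 2 ≤ lam ^ 2 * (a * m) := by
    calc (a * d / 2) ^ 2 ≤ (lam * √(a * m)) ^ 2 := by gcongr
      _ = lam ^ 2 * (a * m) := by rw [mul_pow, Real.sq_sqrt (by positivity)]
  rw [div_mul_eq_mul_div, div_le_iff₀ (by positivity)]
  refine le_of_mul_le_mul_left ?_ ha
  linarith

theorem stmt11 {V : Type*} [Fintype V] [DecidableEq V] (G : SimpleGraph V) [DecidableRel G.Adj]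
    (d : ℕ) (lam : ℝ) (hlam : 0 < lam) (hG : IsExpander G d lam) (A : Finset V)
    (hA : (A.card : ℝ) ≤ (Fintype.card V : ℝ) / 4) :
    min ((Fintype.card V : ℝ) / 4) (((d : ℝ) ^ 2 / (4 * lam ^ 2) - 1) * A.card) ≤
      (((nbr G A) \ A).card : ℝ) := by
  rw [min_le_iff]
  refine (le_total _ _).imp_right fun hsmall => ?_
  have hcard : ((nbr G A).card : ℝ) ≤ ((nbr G A \ A).card : ℝ) + A.card := by
    exact_mod_cast Finset.card_le_card_sdiff_add_card
  have hexp := hG.le_card_nbr hlam (A := A) (by linarith)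
  linarith
end

section
/- Let G be an n-vertex d-regular λ-expander with λ > 0. Then for every non-negative integer t and every vertex v of G, the ball B(v,t) satisfies |B(v,t)| ≥ min{n/2, (d/(2λ))^{2t}}. -/
/-- The ball of radius `t` around `v` in the graph metric of `G`. -/
def gBall {V : Type*} (G : SimpleGraph V) (v : V) (t : ℕ) : Set V :=
  {w | G.Reachable v w ∧ G.dist v w ≤ t}

theorem gBall_mono {V : Type*} (G : SimpleGraph V) (v : V) : Monotone (gBall G v) :=
  fun _ _ hst _ hw => ⟨hw.1, hw.2.trans hst⟩

theorem mem_gBall_succ_of_adj {V : Type*} {G : SimpleGraph V} {v a b : V} {t : ℕ}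
    (ha : a ∈ gBall G v t) (hab : G.Adj a b) : b ∈ gBall G v (t + 1) := by
  obtain ⟨hr, hd⟩ := ha
  obtain ⟨p, hp⟩ := hr.exists_walk_length_eq_dist
  refine ⟨hr.trans hab.reachable, (SimpleGraph.dist_le (p.concat hab)).trans ?_⟩
  rw [SimpleGraph.Walk.length_concat]
  omega

/-- If `T` contains all neighbours of `S`, every edge leaving a vertex of `S` is counted. -/
theorem edgeCount_eq_of_adj_mem {V : Type*} [Fintype V] {G : SimpleGraph V} [DecidableRel G.Adj]
    {d : ℕ} (hd : ∀ v, G.degree v = d) {S T : Finset V}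
    (hST : ∀ a ∈ S, ∀ b, G.Adj a b → b ∈ T) : edgeCount G S T = S.card * d := by
  rw [edgeCount, Finset.card_filter, Finset.sum_product]
  refine Finset.sum_const_nat fun a ha => ?_
  rw [← Finset.card_filter, ← hd a, ← SimpleGraph.card_neighborFinset_eq_degree]
  congr 1
  ext b
  simpa using hST a ha b

/-- In an expander, a set `T` of fewer than half the vertices containing all neighbours of `S`
has size at least `(d / (2 * lam)) ^ 2` times that of `S`. -/
theorem IsExpander.sq_mul_card_le {V : Type*} [Fintype V] {G : SimpleGraph V}
    [DecidableRel G.Adj] {d : ℕ} {lam : ℝ} (hlam : 0 < lam) (hG : IsExpander G d lam)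
    {S T : Finset V} (hST : ∀ a ∈ S, ∀ b, G.Adj a b → b ∈ T)
    (hT : (T.card : ℝ) < (Fintype.card V : ℝ) / 2) :
    ((d : ℝ) / (2 * lam)) ^ 2 * S.card ≤ T.card := by
  have hexp := (abs_le.mp (hG.2 S T)).2
  rw [edgeCount_eq_of_adj_mem hG.1 hST] at hexp
  push_cast at hexp
  have hT0 : (0 : ℝ) ≤ T.card := Nat.cast_nonneg _
  have hn : (0 : ℝ) < Fintype.card V := by linarith
  have hratio : (T.card : ℝ) / Fintype.card V ≤ 1 / 2 := by
    rw [div_le_iff₀ hn]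
    linarith
  have hmain : (d : ℝ) / Fintype.card V * S.card * T.card ≤ S.card * d / 2 := by
    have h := mul_le_mul_of_nonneg_left hratio (by positivity : (0 : ℝ) ≤ S.card * d)
    calc (d : ℝ) / Fintype.card V * S.card * T.card
        = S.card * d * (T.card / Fintype.card V) := by ring
      _ ≤ S.card * d / 2 := by linarith
  rcases (Nat.cast_nonneg S.card : (0 : ℝ) ≤ S.card).eq_or_lt with hS | hS
  · rw [← hS, mul_zero]
    exact hT0
  have hsqrt : (S.card : ℝ) * d / 2 ≤ lam * Real.sqrt (S.card * T.card) := by linarith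
  have hsq := pow_le_pow_left₀ (by positivity) hsqrt 2
  rw [mul_pow, Real.sq_sqrt (by positivity)] at hsq
  have hcancel : (S.card : ℝ) * d ^ 2 ≤ T.card * (4 * lam ^ 2) := by
    refine le_of_mul_le_mul_left ?_ hS
    linarith
  calc ((d : ℝ) / (2 * lam)) ^ 2 * S.card = S.card * d ^ 2 / (4 * lam ^ 2) := by ring
    _ ≤ (T.card : ℝ) := (div_le_iff₀ (by positivity)).mpr hcancel

theorem stmt12 {V : Type*} [Fintype V] (G : SimpleGraph V) [DecidableRel G.Adj]
    (d : ℕ) (lam : ℝ) (hlam : 0 < lam) (hG : IsExpander G d lam)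
    (t : ℕ) (v : V) :
    min ((Fintype.card V : ℝ) / 2) (((d : ℝ) / (2 * lam)) ^ (2 * t)) ≤
      ((gBall G v t).ncard : ℝ) := by
  classical
  induction t with
  | zero =>
    have hpos : 0 < (gBall G v 0).ncard :=
      (Set.ncard_pos (Set.toFinite _)).mpr ⟨v, SimpleGraph.Reachable.refl v, by simp⟩
    refine (min_le_right _ _).trans ?_
    rw [mul_zero, pow_zero]
    exact_mod_cast hpos
  | succ t ih =>
    have hmono : ((gBall G v t).ncard : ℝ) ≤ (gBall G v (t + 1)).ncard := by
      exact_mod_cast Set.ncard_le_ncard (gBall_mono G v t.le_succ) (Set.toFinite _)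
    rcases le_or_gt ((Fintype.card V : ℝ) / 2) (gBall G v (t + 1)).ncard with hbig | hsmall
    · exact (min_le_left _ _).trans hbig
    have hpow : ((d : ℝ) / (2 * lam)) ^ (2 * t) ≤ (gBall G v t).ncard :=
      (min_le_iff.mp ih).resolve_left fun h => (h.trans hmono).not_gt hsmall
    have hstep := hG.sq_mul_card_le hlam (S := (gBall G v t).toFinset)
      (T := (gBall G v (t + 1)).toFinset)
      (fun a ha b hab => Set.mem_toFinset.mpr
        (mem_gBall_succ_of_adj (Set.mem_toFinset.mp ha) hab))
      (by rwa [← Set.ncard_eq_toFinset_card'])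
    rw [← Set.ncard_eq_toFinset_card', ← Set.ncard_eq_toFinset_card'] at hstep
    refine (min_le_right _ _).trans (le_trans ?_ hstep)
    rw [mul_add, mul_one, pow_add, mul_comm]
    gcongr
end

section
/- Let G be a 2n-vertex d-regular λ-bi-expander with λ > 0. Then for every non-negative integer t and every vertex v of G, the ball B(v,t) satisfies |B(v,t)| ≥ min{n/2, (d/(2λ))^{2t}}. -/
theorem edgeCount_eq_sum {V : Type*} (G : SimpleGraph V) [DecidableRel G.Adj]
    (S T : Finset V) : edgeCount G S T = ∑ a ∈ S, (T.filter (G.Adj a)).card := by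
  simp only [edgeCount, Finset.card_filter, Finset.sum_product]

theorem edgeCount_comm {V : Type*} (G : SimpleGraph V) [DecidableRel G.Adj]
    (S T : Finset V) : edgeCount G S T = edgeCount G T S := by
  simp only [edgeCount, Finset.card_filter, Finset.sum_product]
  rw [Finset.sum_comm]
  simp only [G.adj_comm]

theorem IsBiExpander.symm {V : Type*} [Fintype V] {G : SimpleGraph V} [DecidableRel G.Adj]
    {V0 V1 : Finset V} {n d : ℕ} {lam : ℝ} (hG : IsBiExpander G V0 V1 n d lam) :
    IsBiExpander G V1 V0 n d lam := by
  obtain ⟨hV, h0, h1, hcov, hdis, hadj, hdeg, hexp⟩ := hG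
  refine ⟨hV, h1, h0, fun v => (hcov v).symm, hdis.symm, fun u v h => (hadj u v h).symm,
    hdeg, fun S T hS hT => ?_⟩
  have h := hexp T S hT hS
  rwa [edgeCount_comm, mul_right_comm, mul_comm (T.card : ℝ)] at h

/-- The neighbourhood of a one-sided set lies on the other side, and either occupies half of that
side or is larger than the set by a factor of `(d / (2 * lam)) ^ 2`. -/
theorem IsBiExpander.card_neighbors {V : Type*} [Fintype V] {G : SimpleGraph V}
    [DecidableRel G.Adj] {V0 V1 : Finset V} {n d : ℕ} {lam : ℝ} (hlam : 0 < lam)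
    (hG : IsBiExpander G V0 V1 n d lam) {S : Finset V} (hS : S ⊆ V0) :
    ∃ T ⊆ V1, (∀ b ∈ T, ∃ a ∈ S, G.Adj a b) ∧
      ((n : ℝ) / 2 ≤ T.card ∨ ((d : ℝ) / (2 * lam)) ^ 2 * S.card ≤ T.card) := by
  classical
  obtain ⟨-, -, -, -, hdis, hadj, hdeg, hexp⟩ := hG
  have hT : (S.biUnion fun a => G.neighborFinset a) ⊆ V1 := by
    intro b hb
    obtain ⟨a, ha, hab⟩ := Finset.mem_biUnion.1 hb
    rcases hadj a b ((G.mem_neighborFinset a b).1 hab) with h | h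
    · exact h.2
    · exact absurd h.1 (Finset.disjoint_left.1 hdis (hS ha))
  have hcount : edgeCount G S (S.biUnion fun a => G.neighborFinset a) = S.card * d := by
    rw [edgeCount_eq_sum, Finset.sum_const_nat]
    intro a ha
    rw [← hdeg a, ← G.card_neighborFinset_eq_degree]
    congr 1
    ext b
    simp only [Finset.mem_filter, Finset.mem_biUnion, SimpleGraph.mem_neighborFinset]
    exact ⟨fun h => h.2, fun h => ⟨⟨a, ha, h⟩, h⟩⟩
  have hbound := (abs_le.1 (hexp S _ hS hT)).2
  rw [hcount] at hbound
  refine ⟨S.biUnion fun a => G.neighborFinset a, hT, fun b hb => by simpa using hb, ?_⟩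
  generalize (S.biUnion fun a => G.neighborFinset a).card = τ at hbound
  by_contra! hcon
  obtain ⟨hhalf, hlt⟩ := hcon
  have hs : (0 : ℝ) < S.card := by
    rcases S.card.eq_zero_or_pos with h | h
    · rw [h] at hlt
      have : (0 : ℝ) ≤ τ := by positivity
      norm_num at hlt
      linarith
    · exact_mod_cast h
  have hn : (0 : ℝ) < n := by
    have : (0 : ℝ) ≤ τ := by positivity
    linarith
  have hden : (d : ℝ) / n * S.card * τ ≤ d * S.card / 2 := by
    rw [div_mul_eq_mul_div, div_mul_eq_mul_div, div_le_iff₀ hn]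
    have : (0 : ℝ) ≤ d * S.card := by positivity
    nlinarith
  have hroot : (d : ℝ) * S.card / 2 ≤ lam * Real.sqrt (S.card * τ) := by
    push_cast at hbound
    linarith
  have hsq := pow_le_pow_left₀ (by positivity) hroot 2
  rw [mul_pow, Real.sq_sqrt (by positivity)] at hsq
  rw [div_pow, div_mul_eq_mul_div, lt_div_iff₀ (by positivity)] at hlt
  nlinarith

/-- Every ball contains a one-sided set of the size claimed for the ball. -/
theorem IsBiExpander.exists_subset_gBall {V : Type*} [Fintype V] {G : SimpleGraph V}
    [DecidableRel G.Adj] {V0 V1 : Finset V} {n d : ℕ} {lam : ℝ} (hlam : 0 < lam)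
    (hG : IsBiExpander G V0 V1 n d lam) (v : V) (t : ℕ) :
    ∃ S : Finset V, (S ⊆ V0 ∨ S ⊆ V1) ∧ (∀ a ∈ S, a ∈ gBall G v t) ∧
      ((n : ℝ) / 2 ≤ S.card ∨ ((d : ℝ) / (2 * lam)) ^ (2 * t) ≤ S.card) := by
  induction t with
  | zero =>
    refine ⟨{v}, ?_, ?_, Or.inr (by simp)⟩
    · simpa using hG.2.2.2.1 v
    · simp [gBall]
  | succ t ih =>
    obtain ⟨S, hside, hball, hhalf | hcard⟩ := ih
    · exact ⟨S, hside, fun a ha => ⟨(hball a ha).1, (hball a ha).2.trans t.le_succ⟩,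
        Or.inl hhalf⟩
    · have hnext : ∃ T : Finset V, (T ⊆ V0 ∨ T ⊆ V1) ∧ (∀ b ∈ T, ∃ a ∈ S, G.Adj a b) ∧
          ((n : ℝ) / 2 ≤ T.card ∨ ((d : ℝ) / (2 * lam)) ^ 2 * S.card ≤ T.card) := by
        rcases hside with h | h
        · obtain ⟨T, hT, hrest⟩ := hG.card_neighbors hlam h
          exact ⟨T, Or.inr hT, hrest⟩
        · obtain ⟨T, hT, hrest⟩ := hG.symm.card_neighbors hlam h
          exact ⟨T, Or.inl hT, hrest⟩
      obtain ⟨T, hT, hnbr, hTcard⟩ := hnext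
      refine ⟨T, hT, fun b hb => ?_, hTcard.imp_right fun h => le_trans ?_ h⟩
      · obtain ⟨a, ha, hab⟩ := hnbr b hb
        exact mem_gBall_succ_of_adj (hball a ha) hab
      · rw [mul_add, mul_one, pow_add, mul_comm]
        exact mul_le_mul_of_nonneg_left hcard (by positivity)

theorem stmt17 {V : Type*} [Fintype V] (G : SimpleGraph V) [DecidableRel G.Adj]
    (V0 V1 : Finset V) (n d : ℕ) (lam : ℝ) (hlam : 0 < lam)
    (hG : IsBiExpander G V0 V1 n d lam) (t : ℕ) (v : V) :
    min ((n : ℝ) / 2) (((d : ℝ) / (2 * lam)) ^ (2 * t)) ≤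
      ((gBall G v t).ncard : ℝ) := by
  obtain ⟨S, -, hball, hcard⟩ := hG.exists_subset_gBall hlam v t
  have hle : (S.card : ℝ) ≤ (gBall G v t).ncard := by
    rw [← Set.ncard_coe_finset S]
    exact_mod_cast Set.ncard_le_ncard (fun a ha => hball a ha) (Set.toFinite _)
  exact (min_le_iff.2 hcard).trans hle
end

section
/- Let T be a complete (d−1)-ary tree of height h ≥ 1 with d ≥ 2. If A is a nonempty subset of the vertices of T that contains no leaves of T, then the outer boundary satisfies |∂(A)| > (d−2)·|A|. -/
namespace SimpleGraph

/-- In a tree rooted at `u`, a vertex has at most one parent. -/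
theorem IsTree.eq_of_adj_of_dist_eq_dist_add_one {V : Type*} {G : SimpleGraph V} (hG : G.IsTree)
    {u a a' b : V} (hab : G.Adj a b) (hab' : G.Adj a' b)
    (hd : G.dist u b = G.dist u a + 1) (hd' : G.dist u b = G.dist u a' + 1) : a = a' := by
  obtain ⟨p, hp⟩ := hG.connected.exists_walk_length_eq_dist u a
  obtain ⟨q, hq⟩ := hG.connected.exists_walk_length_eq_dist u a'
  have hpath : (p.concat hab).IsPath :=
    Walk.isPath_of_length_eq_dist _ (by rw [Walk.length_concat, hp, hd])
  have hpath' : (q.concat hab').IsPath :=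
    Walk.isPath_of_length_eq_dist _ (by rw [Walk.length_concat, hq, hd'])
  have heq := congrArg Walk.penultimate ((hG.existsUnique_path u b).unique hpath hpath')
  simpa using heq

/-- In a tree rooted at `u`, all neighbors of a vertex but at most one are its children. -/
theorem IsTree.degree_le_card_children_add_one {V : Type*} [Fintype V] {G : SimpleGraph V}
    [DecidableRel G.Adj] (hG : G.IsTree) (u a : V) :
    G.degree a ≤ ((G.neighborFinset a).filter (fun b => G.dist u b = G.dist u a + 1)).card + 1 := by
  rw [← G.card_neighborFinset_eq_degree a, ← Finset.card_filter_add_card_filter_not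
    (s := G.neighborFinset a) (fun b => G.dist u b = G.dist u a + 1)]
  gcongr
  refine Finset.card_le_one.2 fun b hb c hc => ?_
  simp only [Finset.mem_filter, mem_neighborFinset] at hb hc
  exact hG.eq_of_adj_of_dist_eq_dist_add_one hb.1.symm hc.1.symm
    ((hG.dist_eq_dist_add_one_of_adj u hb.1).resolve_right hb.2)
    ((hG.dist_eq_dist_add_one_of_adj u hc.1).resolve_right hc.2)

end SimpleGraph

theorem stmt19 {V : Type*} [Fintype V] [DecidableEq V]
    (T : SimpleGraph V) [DecidableRel T.Adj]
    (d h : ℕ) (vr : V) (hd : 2 ≤ d) (hh : 1 ≤ h)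
    -- `T` is the complete `(d-1)`-ary tree of height `h` with root `vr`:
    (htree : T.IsTree)
    (hdeg : ∀ v : V, T.degree v = 1 ∨ T.degree v = d)
    (hroot : T.degree vr = d)
    (hleaf : ∀ v : V, T.degree v = 1 → T.dist vr v = h)
    (A : Finset V) (hA : A.Nonempty) (hnl : ∀ v ∈ A, T.degree v ≠ 1) :
    (d - 2) * A.card < ((nbr T A) \ A).card := by
  -- Reroot the tree at a vertex `u` of `A`, so that `u` is not a child of any vertex.
  obtain ⟨u, hu⟩ := hA
  let children (a : V) : Finset V :=
    (T.neighborFinset a).filter (fun b => T.dist u b = T.dist u a + 1)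
  have hchildren : ∀ a ∈ A, d - 1 ≤ (children a).card := fun a ha => by
    have hle : T.degree a ≤ (children a).card + 1 := htree.degree_le_card_children_add_one u a
    have hda := (hdeg a).resolve_left (hnl a ha)
    omega
  have hdisj : (A : Set V).PairwiseDisjoint children := by
    intro a _ a' _ hne
    refine Finset.disjoint_left.2 fun b hb hb' => hne ?_
    simp only [children, Finset.mem_filter, SimpleGraph.mem_neighborFinset] at hb hb'
    exact htree.eq_of_adj_of_dist_eq_dist_add_one hb.1 hb'.1 hb.2 hb'.2
  have hlower : A.card * (d - 1) ≤ (A.biUnion children).card := by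
    rw [Finset.card_biUnion hdisj, ← smul_eq_mul]
    exact Finset.card_nsmul_le_sum _ _ _ hchildren
  have hsub : A.biUnion children ⊆ (nbr T A \ A) ∪ A.erase u := by
    intro b hb
    simp only [children, Finset.mem_biUnion, Finset.mem_filter,
      SimpleGraph.mem_neighborFinset] at hb
    obtain ⟨a, ha, hab, hdist⟩ := hb
    have hbu : b ≠ u := by
      rintro rfl
      simp at hdist
    have hnbr : b ∈ nbr T A := Finset.mem_filter.2 ⟨Finset.mem_univ b, a, ha, hab⟩
    by_cases hbA : b ∈ A <;> simp [hbA, hbu, hnbr]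
  have hupper := (Finset.card_le_card hsub).trans (Finset.card_union_le _ _)
  have herase := Finset.card_erase_add_one hu
  obtain ⟨k, rfl⟩ := Nat.exists_eq_add_of_le' hd
  have hmul : A.card * (k + 2 - 1) = k * A.card + A.card := by
    rw [show k + 2 - 1 = k + 1 by omega]
    ring
  rw [Nat.add_sub_cancel]
  omega
end
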